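/- Fix n ∈ ℕ. Let M ⊨ IΔ0 + exp. If M admits a proper Σ_{n+2}-elementary end extension K with K ⊨ M-IΣ_{n+1}, then M satisfies WR(Σ_{n+1} ∧ Π_{n+1}): the weak regularity principle WRφ holds in M for every formula φ(x,y) that is a conjunction of a Σ_{n+1} formula and a Π_{n+1} formula with parameters from M. -/

import Mathlib

namespace PaperArith

/-! ## Syntax of (two-sorted) first-order arithmetic

Terms and formulas of arithmetic in the language `{0, 1, +, ·, <}`,
with number variables and (monadic second-order) set variables both indexed
by natural numbers.  Bounded quantifiers are taken as primitives, so that the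
class `Δ₀` of bounded formulas is a purely syntactic class. -/

/-- Terms of first-order arithmetic in the language `{0, 1, +, ·, <}`. -/
inductive Term : Type
  | var : ℕ → Term
  | zero : Term
  | one : Term
  | add : Term → Term → Term
  | mul : Term → Term → Term

/-- Formulas of (two-sorted) arithmetic.  `mem t i` is the atomic formula
`t ∈ Xᵢ`; `ball x t φ` is `∀ x < t, φ` and `bex x t φ` is `∃ x < t, φ`;
`sall i φ` and `sex i φ` quantify over the set variable `Xᵢ`.
Purely first-order formulas are those avoiding `mem`, `sall`, `sex`. -/
inductive Fml : Type
  | eq : Term → Term → Fml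
  | lt : Term → Term → Fml
  | mem : Term → ℕ → Fml
  | not : Fml → Fml
  | and : Fml → Fml → Fml
  | or : Fml → Fml → Fml
  | imp : Fml → Fml → Fml
  | all : ℕ → Fml → Fml
  | ex : ℕ → Fml → Fml
  | ball : ℕ → Term → Fml → Fml
  | bex : ℕ → Term → Fml → Fml
  | sall : ℕ → Fml → Fml
  | sex : ℕ → Fml → Fml

/-- A structure for the first-order language of arithmetic. -/
structure Str : Type 1 where
  M : Type
  zero : M
  one : M
  add : M → M → M
  mul : M → M → M
  lt : M → M → Prop

/-- Value of a term under a valuation of the number variables. -/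
def tval (S : Str) (v : ℕ → S.M) : Term → S.M
  | .var i => v i
  | .zero => S.zero
  | .one => S.one
  | .add t u => S.add (tval S v t) (tval S v u)
  | .mul t u => S.mul (tval S v t) (tval S v u)

/-- Update a valuation at one variable. -/
def upd {α : Type} (v : ℕ → α) (x : ℕ) (a : α) : ℕ → α :=
  fun i => if i = x then a else v i

/-- Tarskian satisfaction over the structure `S`, with second-order universe
`X` (set quantifiers range over `X`); `v` is the valuation of number
variables, `w` the valuation of set variables. -/
def Sat (S : Str) (X : Set (Set S.M)) : (ℕ → S.M) → (ℕ → Set S.M) → Fml → Prop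
  | v, _, .eq t u => tval S v t = tval S v u
  | v, _, .lt t u => S.lt (tval S v t) (tval S v u)
  | v, w, .mem t i => tval S v t ∈ w i
  | v, w, .not φ => ¬ Sat S X v w φ
  | v, w, .and φ ψ => Sat S X v w φ ∧ Sat S X v w ψ
  | v, w, .or φ ψ => Sat S X v w φ ∨ Sat S X v w ψ
  | v, w, .imp φ ψ => Sat S X v w φ → Sat S X v w ψ
  | v, w, .all x φ => ∀ m : S.M, Sat S X (upd v x m) w φ
  | v, w, .ex x φ => ∃ m : S.M, Sat S X (upd v x m) w φ
  | v, w, .ball x t φ => ∀ m : S.M, S.lt m (tval S v t) → Sat S X (upd v x m) w φ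
  | v, w, .bex x t φ => ∃ m : S.M, S.lt m (tval S v t) ∧ Sat S X (upd v x m) w φ
  | v, w, .sall i φ => ∀ A : Set S.M, A ∈ X → Sat S X v (upd w i A) φ
  | v, w, .sex i φ => ∃ A : Set S.M, A ∈ X ∧ Sat S X v (upd w i A) φ

/-- First-order satisfaction (for purely first-order formulas the second-order
data is irrelevant). -/
def Sat0 (S : Str) (v : ℕ → S.M) (φ : Fml) : Prop :=
  Sat S ∅ v (fun _ => ∅) φ

/-! ## The arithmetic hierarchy -/

/-- `Δ₀` formulas: purely first-order, only bounded quantifiers. -/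
inductive Delta0 : Fml → Prop
  | eq (t u : Term) : Delta0 (.eq t u)
  | lt (t u : Term) : Delta0 (.lt t u)
  | not {φ : Fml} : Delta0 φ → Delta0 (.not φ)
  | and {φ ψ : Fml} : Delta0 φ → Delta0 ψ → Delta0 (.and φ ψ)
  | or {φ ψ : Fml} : Delta0 φ → Delta0 ψ → Delta0 (.or φ ψ)
  | imp {φ ψ : Fml} : Delta0 φ → Delta0 ψ → Delta0 (.imp φ ψ)
  | ball (x : ℕ) (t : Term) {φ : Fml} : Delta0 φ → Delta0 (.ball x t φ)
  | bex (x : ℕ) (t : Term) {φ : Fml} : Delta0 φ → Delta0 (.bex x t φ)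

mutual
  /-- `Σₙ` formulas of the first-order arithmetic hierarchy. -/
  inductive IsSigma : ℕ → Fml → Prop
    | delta0 {n : ℕ} {φ : Fml} : Delta0 φ → IsSigma n φ
    | ofPi {n : ℕ} {φ : Fml} : IsPi n φ → IsSigma (n + 1) φ
    | ex (x : ℕ) {n : ℕ} {φ : Fml} : IsSigma (n + 1) φ → IsSigma (n + 1) (.ex x φ)
  /-- `Πₙ` formulas of the first-order arithmetic hierarchy. -/
  inductive IsPi : ℕ → Fml → Prop
    | delta0 {n : ℕ} {φ : Fml} : Delta0 φ → IsPi n φ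
    | ofSigma {n : ℕ} {φ : Fml} : IsSigma n φ → IsPi (n + 1) φ
    | all (x : ℕ) {n : ℕ} {φ : Fml} : IsPi (n + 1) φ → IsPi (n + 1) (.all x φ)
end

/-- `Σ₀(Σₙ)`: the closure of `Σₙ` under Boolean operations and bounded
quantification. -/
inductive Sigma0Sigma (n : ℕ) : Fml → Prop
  | ofSigma {φ : Fml} : IsSigma n φ → Sigma0Sigma n φ
  | not {φ : Fml} : Sigma0Sigma n φ → Sigma0Sigma n (.not φ)
  | and {φ ψ : Fml} : Sigma0Sigma n φ → Sigma0Sigma n ψ → Sigma0Sigma n (.and φ ψ)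
  | or {φ ψ : Fml} : Sigma0Sigma n φ → Sigma0Sigma n ψ → Sigma0Sigma n (.or φ ψ)
  | imp {φ ψ : Fml} : Sigma0Sigma n φ → Sigma0Sigma n ψ → Sigma0Sigma n (.imp φ ψ)
  | ball (x : ℕ) (t : Term) {φ : Fml} : Sigma0Sigma n φ → Sigma0Sigma n (.ball x t φ)
  | bex (x : ℕ) (t : Term) {φ : Fml} : Sigma0Sigma n φ → Sigma0Sigma n (.bex x t φ)

/-- The class `Σₙ ∧ Πₙ` of conjunctions of a `Σₙ` and a `Πₙ` formula. -/
def SigmaAndPi (n : ℕ) (φ : Fml) : Prop :=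
  ∃ ψ χ : Fml, IsSigma n ψ ∧ IsPi n χ ∧ φ = Fml.and ψ χ

/-- The class `Σₙ ∨ Πₙ` of disjunctions of a `Σₙ` and a `Πₙ` formula. -/
def SigmaOrPi (n : ℕ) (φ : Fml) : Prop :=
  ∃ ψ χ : Fml, IsSigma n ψ ∧ IsPi n χ ∧ φ = Fml.or ψ χ

/-- `Δ₀⁰` formulas of second-order arithmetic: only bounded first-order
quantifiers; free set variables (set parameters) are allowed. -/
inductive Delta0SO : Fml → Prop
  | eq (t u : Term) : Delta0SO (.eq t u)
  | lt (t u : Term) : Delta0SO (.lt t u)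
  | mem (t : Term) (i : ℕ) : Delta0SO (.mem t i)
  | not {φ : Fml} : Delta0SO φ → Delta0SO (.not φ)
  | and {φ ψ : Fml} : Delta0SO φ → Delta0SO ψ → Delta0SO (.and φ ψ)
  | or {φ ψ : Fml} : Delta0SO φ → Delta0SO ψ → Delta0SO (.or φ ψ)
  | imp {φ ψ : Fml} : Delta0SO φ → Delta0SO ψ → Delta0SO (.imp φ ψ)
  | ball (x : ℕ) (t : Term) {φ : Fml} : Delta0SO φ → Delta0SO (.ball x t φ)
  | bex (x : ℕ) (t : Term) {φ : Fml} : Delta0SO φ → Delta0SO (.bex x t φ)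

mutual
  /-- `Σₙ⁰` formulas of the second-order arithmetic hierarchy
  (set parameters allowed, no set quantifiers). -/
  inductive SigmaSO : ℕ → Fml → Prop
    | delta0 {n : ℕ} {φ : Fml} : Delta0SO φ → SigmaSO n φ
    | ofPi {n : ℕ} {φ : Fml} : PiSO n φ → SigmaSO (n + 1) φ
    | ex (x : ℕ) {n : ℕ} {φ : Fml} : SigmaSO (n + 1) φ → SigmaSO (n + 1) (.ex x φ)
  /-- `Πₙ⁰` formulas of the second-order arithmetic hierarchy. -/
  inductive PiSO : ℕ → Fml → Prop
    | delta0 {n : ℕ} {φ : Fml} : Delta0SO φ → PiSO n φ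
    | ofSigma {n : ℕ} {φ : Fml} : SigmaSO n φ → PiSO (n + 1) φ
    | all (x : ℕ) {n : ℕ} {φ : Fml} : PiSO (n + 1) φ → PiSO (n + 1) (.all x φ)
end

/-! ## First-order theories -/

/-- `PA⁻`: the theory of non-negative parts of discretely ordered rings. -/
structure PAminus (S : Str) : Prop where
  add_assoc : ∀ a b c, S.add (S.add a b) c = S.add a (S.add b c)
  add_comm : ∀ a b, S.add a b = S.add b a
  mul_assoc : ∀ a b c, S.mul (S.mul a b) c = S.mul a (S.mul b c)
  mul_comm : ∀ a b, S.mul a b = S.mul b a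
  distrib : ∀ a b c, S.mul a (S.add b c) = S.add (S.mul a b) (S.mul a c)
  add_zero : ∀ a, S.add a S.zero = a
  mul_zero : ∀ a, S.mul a S.zero = S.zero
  mul_one : ∀ a, S.mul a S.one = a
  lt_irrefl : ∀ a, ¬ S.lt a a
  lt_trans : ∀ a b c, S.lt a b → S.lt b c → S.lt a c
  lt_total : ∀ a b, S.lt a b ∨ a = b ∨ S.lt b a
  add_lt_add : ∀ a b c, S.lt a b → S.lt (S.add a c) (S.add b c)
  mul_lt_mul : ∀ a b c, S.lt a b → S.lt S.zero c → S.lt (S.mul a c) (S.mul b c)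
  zero_lt_one : S.lt S.zero S.one
  zero_le : ∀ a, a = S.zero ∨ S.lt S.zero a
  discrete : ∀ a b, S.lt a b → S.add a S.one = b ∨ S.lt (S.add a S.one) b
  pred : ∀ a, S.lt S.zero a → ∃ b, S.add b S.one = a
  sub : ∀ a b, S.lt a b → ∃ c, S.add a c = b

/-- The induction scheme for the class `Γ` of formulas
(parameters are allowed via the ambient valuation `v`). -/
def IndFor (S : Str) (Γ : Fml → Prop) : Prop :=
  ∀ φ : Fml, Γ φ → ∀ (v : ℕ → S.M) (x : ℕ),
    Sat0 S (upd v x S.zero) φ →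
    (∀ m, Sat0 S (upd v x m) φ → Sat0 S (upd v x (S.add m S.one)) φ) →
    ∀ m, Sat0 S (upd v x m) φ

/-- The collection scheme for the class `Γ`:
`(∀ x < a ∃ y φ) → (∃ b ∀ x < a ∃ y < b φ)`. -/
def CollFor (S : Str) (Γ : Fml → Prop) : Prop :=
  ∀ φ : Fml, Γ φ → ∀ (v : ℕ → S.M) (x y : ℕ), x ≠ y → ∀ a : S.M,
    (∀ m, S.lt m a → ∃ k, Sat0 S (upd (upd v x m) y k) φ) →
    ∃ b, ∀ m, S.lt m a → ∃ k, S.lt k b ∧ Sat0 S (upd (upd v x m) y k) φ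

/-- `IΔ₀` (over `PA⁻`). -/
def IDelta0 (S : Str) : Prop := PAminus S ∧ IndFor S Delta0

/-- `IΣₙ` (over `PA⁻`; note `Δ₀ ⊆ Σₙ`, so this includes `IΔ₀`). -/
def ISigma (S : Str) (n : ℕ) : Prop := PAminus S ∧ IndFor S (IsSigma n)

/-- `BΣₙ`: the `Σₙ`-collection scheme, including `IΔ₀` (over `PA⁻`). -/
def BSigma (S : Str) (n : ℕ) : Prop := IDelta0 S ∧ CollFor S (IsSigma n)

/-- The weak regularity principle `WRφ` for all `φ` in the class `Γ`:
the universal closure of `(∀ x ∃ y < a φ(x,y)) → (∃ y < a ∀ b ∃ x > b φ(x,y))`.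
Here `x, y` are the two displayed variables and all other free variables of
`φ` are parameters, interpreted by the ambient valuation `v`. -/
def WRFor (S : Str) (Γ : Fml → Prop) : Prop :=
  ∀ φ : Fml, Γ φ → ∀ (v : ℕ → S.M) (x y : ℕ), x ≠ y → ∀ a : S.M,
    (∀ m, ∃ k, S.lt k a ∧ Sat0 S (upd (upd v x m) y k) φ) →
    ∃ k, S.lt k a ∧ ∀ b, ∃ m, S.lt b m ∧ Sat0 S (upd (upd v x m) y k) φ

/-! ## Second-order theories -/

/-- Second-order induction scheme for the class `Γ`, with set parameters
from the second-order universe `X`. -/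
def IndForSO (S : Str) (X : Set (Set S.M)) (Γ : Fml → Prop) : Prop :=
  ∀ φ : Fml, Γ φ → ∀ (v : ℕ → S.M) (w : ℕ → Set S.M), (∀ i, w i ∈ X) → ∀ x : ℕ,
    Sat S X (upd v x S.zero) w φ →
    (∀ m, Sat S X (upd v x m) w φ → Sat S X (upd v x (S.add m S.one)) w φ) →
    ∀ m, Sat S X (upd v x m) w φ

/-- Second-order collection scheme for the class `Γ`. -/
def CollForSO (S : Str) (X : Set (Set S.M)) (Γ : Fml → Prop) : Prop :=
  ∀ φ : Fml, Γ φ → ∀ (v : ℕ → S.M) (w : ℕ → Set S.M), (∀ i, w i ∈ X) →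
    ∀ (x y : ℕ), x ≠ y → ∀ a : S.M,
    (∀ m, S.lt m a → ∃ k, Sat S X (upd (upd v x m) y k) w φ) →
    ∃ b, ∀ m, S.lt m a → ∃ k, S.lt k b ∧ Sat S X (upd (upd v x m) y k) w φ

/-- `Δ₁⁰`-comprehension. -/
def Delta1CA (S : Str) (X : Set (Set S.M)) : Prop :=
  ∀ φ ψ : Fml, SigmaSO 1 φ → PiSO 1 ψ →
    ∀ (v : ℕ → S.M) (w : ℕ → Set S.M), (∀ i, w i ∈ X) → ∀ x : ℕ,
    (∀ m, Sat S X (upd v x m) w φ ↔ Sat S X (upd v x m) w ψ) →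
    ∃ A ∈ X, ∀ m, m ∈ A ↔ Sat S X (upd v x m) w φ

/-- `Σₙ`-comprehension for first-order formulas with parameters from `M`. -/
def SigmaCA (S : Str) (X : Set (Set S.M)) (n : ℕ) : Prop :=
  ∀ φ : Fml, IsSigma n φ → ∀ (v : ℕ → S.M) (x : ℕ),
    ∃ A ∈ X, ∀ m, m ∈ A ↔ Sat0 S (upd v x m) φ

/-- `RCA₀`. -/
def RCA0 (S : Str) (X : Set (Set S.M)) : Prop :=
  PAminus S ∧ IndForSO S X (SigmaSO 1) ∧ Delta1CA S X

/-- `Σ₁⁰`-separation; over `RCA₀` this is equivalent to weak Kőnig's lemma. -/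
def Sigma1Sep (S : Str) (X : Set (Set S.M)) : Prop :=
  ∀ φ ψ : Fml, SigmaSO 1 φ → SigmaSO 1 ψ →
    ∀ (v : ℕ → S.M) (w : ℕ → Set S.M), (∀ i, w i ∈ X) → ∀ x : ℕ,
    (∀ m, ¬ (Sat S X (upd v x m) w φ ∧ Sat S X (upd v x m) w ψ)) →
    ∃ A ∈ X, ∀ m, (Sat S X (upd v x m) w φ → m ∈ A) ∧ (m ∈ A → ¬ Sat S X (upd v x m) w ψ)

/-- `WKL₀`, rendered as `RCA₀` plus `Σ₁⁰`-separation (which is equivalent,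
over `RCA₀`, to weak Kőnig's lemma). -/
def WKL0 (S : Str) (X : Set (Set S.M)) : Prop := RCA0 S X ∧ Sigma1Sep S X

/-- `BΣₙ⁰`: the second-order `Σₙ⁰`-collection scheme (including `IΔ₀⁰`,
over `PA⁻`). -/
def BSigmaSO (S : Str) (X : Set (Set S.M)) (n : ℕ) : Prop :=
  PAminus S ∧ IndForSO S X Delta0SO ∧ CollForSO S X (SigmaSO n)

/-- `IΣₙ⁰`: the second-order `Σₙ⁰`-induction scheme, over `RCA₀`. -/
def ISigmaSO (S : Str) (X : Set (Set S.M)) (n : ℕ) : Prop :=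
  RCA0 S X ∧ IndForSO S X (SigmaSO n)

/-! ## Exponentiation and binary digits -/

/-- Satisfaction of a three-variable formula `E(x₀, x₁, x₂)` at `(a, b, c)`. -/
def ExpAt (S : Str) (E : Fml) (a b c : S.M) : Prop :=
  Sat0 S (fun i => if i = 0 then a else if i = 1 then b else c) E

/-- `E(x₀,x₁,x₂)` is a `Δ₀` definition of the (total) exponentiation function
`x₀ ^ x₁ = x₂`.  The existence of such an `E` expresses `exp`
(the totality of exponentiation). -/
structure IsExpDef (S : Str) (E : Fml) : Prop where
  delta0 : Delta0 E
  base : ∀ a, ExpAt S E a S.zero S.one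
  total : ∀ a b, ∃ c, ExpAt S E a b c
  unique : ∀ a b c c', ExpAt S E a b c → ExpAt S E a b c' → c = c'
  step : ∀ a b c, ExpAt S E a b c → ExpAt S E a (S.add b S.one) (S.mul c a)

/-- `exp`: the totality of exponentiation (via a `Δ₀` definition of its
graph). -/
def SatExp (S : Str) : Prop := ∃ E : Fml, IsExpDef S E

/-! ## Embeddings, end extensions and elementarity -/

/-- An embedding of arithmetic structures. -/
structure Emb (S K : Str) where
  j : S.M → K.M
  inj : Function.Injective j
  zero : j S.zero = K.zero
  one : j S.one = K.one
  add : ∀ a b, j (S.add a b) = K.add (j a) (j b)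
  mul : ∀ a b, j (S.mul a b) = K.mul (j a) (j b)
  lt_iff : ∀ a b, S.lt a b ↔ K.lt (j a) (j b)

/-- The extension along `e` is an end extension: every element of `K` not in
the image of `M` exceeds every element of `M`. -/
def IsEndExt {S K : Str} (e : Emb S K) : Prop :=
  ∀ b : K.M, b ∉ Set.range e.j → ∀ a : S.M, K.lt (e.j a) b

/-- The extension along `e` is proper. -/
def IsProper {S K : Str} (e : Emb S K) : Prop := ¬ Function.Surjective e.j

/-- The extension along `e` is `Σₙ`-elementary: all `Σₙ` formulas with
parameters from `M` are absolute between `M` and `K`. -/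
def SigmaElem {S K : Str} (e : Emb S K) (n : ℕ) : Prop :=
  ∀ φ : Fml, IsSigma n φ → ∀ v : ℕ → S.M,
    (Sat0 S v φ ↔ Sat0 K (fun i => e.j (v i)) φ)

/-- `K ⊨ M‑IΣₙ` (for an extension `e : M → K`): induction up to any `a ∈ M`
for `Σₙ` formulas with parameters from `K`. -/
def MISigma {S K : Str} (e : Emb S K) (n : ℕ) : Prop :=
  ∀ φ : Fml, IsSigma n φ → ∀ (v : ℕ → K.M) (x : ℕ) (a : S.M),
    Sat0 K (upd v x K.zero) φ →
    (∀ m, K.lt m (e.j a) → (Sat0 K (upd v x m) φ → Sat0 K (upd v x (K.add m K.one)) φ)) →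
    ∀ m, K.lt m (e.j a) → Sat0 K (upd v x m) φ

/-- The `x`-th binary digit of `c ∈ K` is `1`, computed via a `Δ₀` definition
`E` of exponentiation on the ground model `S` (here `x` lies under the image
of `S`): there are `x', p ∈ M` with `j x' = x`, `p = 2 ^ x'`, and `u, v ∈ K`
with `c = u·(2p) + p + v` and `v < p`. -/
def BitVia {S K : Str} (e : Emb S K) (E : Fml) (x c : K.M) : Prop :=
  ∃ x' p : S.M, e.j x' = x ∧ ExpAt S E (S.add S.one S.one) x' p ∧
    ∃ u v : K.M, K.lt v (e.j p) ∧
      c = K.add (K.add (K.mul u (K.add (e.j p) (e.j p))) (e.j p)) v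

/-! ## The second-order restricted ultrapower -/

/-- `A` is cofinal (unbounded) in `S`. -/
def Cofinal (S : Str) (A : Set S.M) : Prop := ∀ b : S.M, ∃ x ∈ A, S.lt b x

/-- The pairing term `⟨x, y⟩ = (x + y)·(x + y) + x`. -/
def pairS (S : Str) (x y : S.M) : S.M := S.add (S.mul (S.add x y) (S.add x y)) x

/-- The graph of `f : M → M`, coded as a subset of `M` via pairing. -/
def graphOf (S : Str) (f : S.M → S.M) : Set S.M := {m | ∃ x, m = pairS S x (f x)}

/-- `f` is a total function `M → M` lying in the second-order universe `X`
(its coded graph belongs to `X`).  The collection of such `f` is the class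
`ℱ` of the restricted ultrapower. -/
def FuncIn (S : Str) (X : Set (Set S.M)) (f : S.M → S.M) : Prop := graphOf S f ∈ X

/-- `U` is an ultrafilter on the Boolean algebra `X`, all of whose elements
are cofinal in `M`. -/
structure UltraOn (S : Str) (X U : Set (Set S.M)) : Prop where
  subset : U ⊆ X
  univ_mem : Set.univ ∈ U
  empty_not_mem : ∅ ∉ U
  inter_mem : ∀ A ∈ U, ∀ B ∈ U, A ∩ B ∈ U
  superset_mem : ∀ A ∈ U, ∀ B ∈ X, A ⊆ B → B ∈ U
  ultra : ∀ A ∈ X, A ∈ U ∨ Aᶜ ∈ U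
  cofinal : ∀ A ∈ U, Cofinal S A

/-- A realization of the second-order restricted ultrapower `ℱ/𝒰` of `S`
with respect to the second-order universe `X` and the ultrafilter `U`:
a structure `K` whose elements are exactly the classes `cls f hf = [f]` of
total functions `f ∈ ℱ`, where `[f] = [g]` iff `f = g` on a set in `U`, with
pointwise arithmetic operations, order decided by `U`, and the inherited
second-order membership relation `memK` serving as the second-order expansion. -/
structure RUP (S : Str) (X U : Set (Set S.M)) : Type 1 where
  K : Str
  cls : (f : S.M → S.M) → FuncIn S X f → K.M
  memK : K.M → Set S.M → Prop
  const_in : ∀ a : S.M, FuncIn S X (fun _ => a)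
  surj : ∀ b : K.M, ∃ (f : S.M → S.M) (hf : FuncIn S X f), cls f hf = b
  eq_iff : ∀ (f : S.M → S.M) (hf : FuncIn S X f) (g : S.M → S.M) (hg : FuncIn S X g),
      (cls f hf = cls g hg) ↔ {i : S.M | f i = g i} ∈ U
  lt_iff : ∀ (f : S.M → S.M) (hf : FuncIn S X f) (g : S.M → S.M) (hg : FuncIn S X g),
      K.lt (cls f hf) (cls g hg) ↔ {i : S.M | S.lt (f i) (g i)} ∈ U
  zero_eq : K.zero = cls (fun _ => S.zero) (const_in S.zero)
  one_eq : K.one = cls (fun _ => S.one) (const_in S.one)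
  add_eq : ∀ (f : S.M → S.M) (hf : FuncIn S X f) (g : S.M → S.M) (hg : FuncIn S X g)
      (h : S.M → S.M) (hh : FuncIn S X h), (∀ i, h i = S.add (f i) (g i)) →
      K.add (cls f hf) (cls g hg) = cls h hh
  mul_eq : ∀ (f : S.M → S.M) (hf : FuncIn S X f) (g : S.M → S.M) (hg : FuncIn S X g)
      (h : S.M → S.M) (hh : FuncIn S X h), (∀ i, h i = S.mul (f i) (g i)) →
      K.mul (cls f hf) (cls g hg) = cls h hh
  mem_iff : ∀ (f : S.M → S.M) (hf : FuncIn S X f) (A : Set S.M), A ∈ X →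
      (memK (cls f hf) A ↔ {i : S.M | f i ∈ A} ∈ U)

/-- The canonical embedding `M → ℱ/𝒰` via constant functions. -/
def RUP.emb {S : Str} {X U : Set (Set S.M)} (R : RUP S X U) (a : S.M) : R.K.M :=
  R.cls (fun _ => a) (R.const_in a)

/-- The subset of `ℱ/𝒰` induced by `A ⊆ M`. -/
def RUP.setImg {S : Str} {X U : Set (Set S.M)} (R : RUP S X U) (A : Set S.M) :
    Set R.K.M := {b | R.memK b A}

/-- The second-order part of the expanded ultrapower `(ℱ/𝒰, 𝒳)`:
the (injected) copy of `X`. -/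
def RUP.X2 {S : Str} {X U : Set (Set S.M)} (R : RUP S X U) : Set (Set R.K.M) :=
  (fun A => R.setImg A) '' X

end PaperArith

namespace PaperArith

/-! ## Substitution of terms for number variables -/

/-- A strict upper bound for the indices of the variables of a term. -/
def Term.vb : Term → ℕ
  | .var i => i + 1
  | .zero => 0
  | .one => 0
  | .add t u => max t.vb u.vb
  | .mul t u => max t.vb u.vb

/-- Simultaneous substitution in terms. -/
def Term.sub (σ : ℕ → Term) : Term → Term
  | .var i => σ i
  | .zero => .zero
  | .one => .one
  | .add t u => .add (t.sub σ) (u.sub σ)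
  | .mul t u => .mul (t.sub σ) (u.sub σ)

/-- A strict upper bound for the indices of the free number variables of a formula. -/
def Fml.vb : Fml → ℕ
  | .eq t u => max t.vb u.vb
  | .lt t u => max t.vb u.vb
  | .mem t _ => t.vb
  | .not φ => φ.vb
  | .and φ ψ => max φ.vb ψ.vb
  | .or φ ψ => max φ.vb ψ.vb
  | .imp φ ψ => max φ.vb ψ.vb
  | .all _ φ => φ.vb
  | .ex _ φ => φ.vb
  | .ball _ t φ => max t.vb φ.vb
  | .bex _ t φ => max t.vb φ.vb
  | .sall _ φ => φ.vb
  | .sex _ φ => φ.vb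

/-- A variable not occurring in any of the terms `σ 0, …, σ (n - 1)`. -/
def freshVar (σ : ℕ → Term) (n : ℕ) : ℕ := (Finset.range n).sup fun i => (σ i).vb

/-- Capture-avoiding simultaneous substitution of terms for the number variables of a
first-order formula. -/
def Fml.sub : (ℕ → Term) → Fml → Fml
  | σ, .eq t u => .eq (t.sub σ) (u.sub σ)
  | σ, .lt t u => .lt (t.sub σ) (u.sub σ)
  | σ, .mem t i => .mem (t.sub σ) i
  | σ, .not φ => .not (φ.sub σ)
  | σ, .and φ ψ => .and (φ.sub σ) (ψ.sub σ)
  | σ, .or φ ψ => .or (φ.sub σ) (ψ.sub σ)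
  | σ, .imp φ ψ => .imp (φ.sub σ) (ψ.sub σ)
  | σ, .all x φ => .all (freshVar σ φ.vb) (φ.sub (upd σ x (.var (freshVar σ φ.vb))))
  | σ, .ex x φ => .ex (freshVar σ φ.vb) (φ.sub (upd σ x (.var (freshVar σ φ.vb))))
  | σ, .ball x t φ =>
      .ball (freshVar σ φ.vb) (t.sub σ) (φ.sub (upd σ x (.var (freshVar σ φ.vb))))
  | σ, .bex x t φ =>
      .bex (freshVar σ φ.vb) (t.sub σ) (φ.sub (upd σ x (.var (freshVar σ φ.vb))))
  | _, .sall i φ => .sall i φ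
  | _, .sex i φ => .sex i φ

section Satisfaction

variable {T : Str} {v v' : ℕ → T.M}

@[simp] theorem sat0_eq {t u : Term} : Sat0 T v (.eq t u) ↔ tval T v t = tval T v u := Iff.rfl
@[simp] theorem sat0_lt {t u : Term} : Sat0 T v (.lt t u) ↔ T.lt (tval T v t) (tval T v u) :=
  Iff.rfl
@[simp] theorem sat0_mem {t : Term} {i : ℕ} : ¬ Sat0 T v (.mem t i) := fun h => h
@[simp] theorem sat0_not {φ : Fml} : Sat0 T v (.not φ) ↔ ¬ Sat0 T v φ := Iff.rfl
@[simp] theorem sat0_and {φ ψ : Fml} : Sat0 T v (.and φ ψ) ↔ Sat0 T v φ ∧ Sat0 T v ψ := Iff.rfl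
@[simp] theorem sat0_or {φ ψ : Fml} : Sat0 T v (.or φ ψ) ↔ Sat0 T v φ ∨ Sat0 T v ψ := Iff.rfl
@[simp] theorem sat0_imp {φ ψ : Fml} : Sat0 T v (.imp φ ψ) ↔ (Sat0 T v φ → Sat0 T v ψ) := Iff.rfl
@[simp] theorem sat0_all {x : ℕ} {φ : Fml} :
    Sat0 T v (.all x φ) ↔ ∀ m, Sat0 T (upd v x m) φ := Iff.rfl
@[simp] theorem sat0_ex {x : ℕ} {φ : Fml} :
    Sat0 T v (.ex x φ) ↔ ∃ m, Sat0 T (upd v x m) φ := Iff.rfl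
@[simp] theorem sat0_ball {x : ℕ} {t : Term} {φ : Fml} :
    Sat0 T v (.ball x t φ) ↔ ∀ m, T.lt m (tval T v t) → Sat0 T (upd v x m) φ := Iff.rfl
@[simp] theorem sat0_bex {x : ℕ} {t : Term} {φ : Fml} :
    Sat0 T v (.bex x t φ) ↔ ∃ m, T.lt m (tval T v t) ∧ Sat0 T (upd v x m) φ := Iff.rfl
@[simp] theorem sat0_sall {i : ℕ} {φ : Fml} : Sat0 T v (.sall i φ) := fun _ h => h.elim
@[simp] theorem sat0_sex {i : ℕ} {φ : Fml} : ¬ Sat0 T v (.sex i φ) := fun ⟨_, h, _⟩ => h.elim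

theorem tval_congr {t : Term} (h : ∀ i < t.vb, v i = v' i) : tval T v t = tval T v' t := by
  induction t with
  | var i => exact h i (Nat.lt_succ_self i)
  | zero => rfl
  | one => rfl
  | add t u iht ihu | mul t u iht ihu =>
    simp only [Term.vb, lt_max_iff] at h
    simp only [tval, iht fun i hi => h i (.inl hi), ihu fun i hi => h i (.inr hi)]

theorem upd_congr {x n : ℕ} (m : T.M) (h : ∀ i < n, v i = v' i) :
    ∀ i < n, upd v x m i = upd v' x m i := by
  intro i hi
  simp only [upd, h i hi]

theorem sat0_congr {φ : Fml} (h : ∀ i < φ.vb, v i = v' i) : Sat0 T v φ ↔ Sat0 T v' φ := by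
  induction φ generalizing v v' with
  | eq t u | lt t u =>
    simp only [Fml.vb, lt_max_iff] at h
    simp only [sat0_eq, sat0_lt, tval_congr fun i hi => h i (.inl hi),
      tval_congr fun i hi => h i (.inr hi)]
  | mem t i => simp
  | not φ ih => simp only [sat0_not, ih h]
  | and φ ψ ih ih' | or φ ψ ih ih' | imp φ ψ ih ih' =>
    simp only [Fml.vb, lt_max_iff] at h
    simp only [sat0_and, sat0_or, sat0_imp, ih fun i hi => h i (.inl hi),
      ih' fun i hi => h i (.inr hi)]
  | all x φ ih => exact forall_congr' fun m => ih (upd_congr m h)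
  | ex x φ ih => exact exists_congr fun m => ih (upd_congr m h)
  | ball x t φ ih =>
    simp only [Fml.vb, lt_max_iff] at h
    simp only [sat0_ball, tval_congr fun i hi => h i (.inl hi)]
    exact forall_congr' fun m => imp_congr_right fun _ =>
      ih (upd_congr m fun i hi => h i (.inr hi))
  | bex x t φ ih =>
    simp only [Fml.vb, lt_max_iff] at h
    simp only [sat0_bex, tval_congr fun i hi => h i (.inl hi)]
    exact exists_congr fun m => and_congr_right fun _ =>
      ih (upd_congr m fun i hi => h i (.inr hi))
  | sall i φ ih => simp
  | sex i φ ih => simp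

theorem tval_sub {σ : ℕ → Term} (t : Term) :
    tval T v (t.sub σ) = tval T (fun i => tval T v (σ i)) t := by
  induction t with
  | var i => rfl
  | zero => rfl
  | one => rfl
  | add t u iht ihu | mul t u iht ihu => simp only [Term.sub, tval, iht, ihu]

theorem tval_upd_freshVar {σ : ℕ → Term} {n x : ℕ} (m : T.M) :
    ∀ i < n, tval T (upd v (freshVar σ n) m) (upd σ x (.var (freshVar σ n)) i) =
      upd (fun i => tval T v (σ i)) x m i := by
  intro i hi
  by_cases hx : i = x
  · simp [upd, hx, tval]
  · simp only [upd, hx, if_false]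
    refine tval_congr fun j hj => ?_
    have : (σ i).vb ≤ freshVar σ n :=
      Finset.le_sup (f := fun i => (σ i).vb) (Finset.mem_range.2 hi)
    exact if_neg (by omega)

theorem sat0_sub {φ : Fml} {σ : ℕ → Term} :
    Sat0 T v (φ.sub σ) ↔ Sat0 T (fun i => tval T v (σ i)) φ := by
  induction φ generalizing v σ with
  | eq t u | lt t u => simp only [Fml.sub, sat0_eq, sat0_lt, tval_sub]
  | mem t i => simp [Fml.sub]
  | not φ ih => simp only [Fml.sub, sat0_not, ih]
  | and φ ψ ih ih' | or φ ψ ih ih' | imp φ ψ ih ih' =>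
    simp only [Fml.sub, sat0_and, sat0_or, sat0_imp, ih, ih']
  | all x φ ih => exact forall_congr' fun m => ih.trans (sat0_congr (tval_upd_freshVar m))
  | ex x φ ih => exact exists_congr fun m => ih.trans (sat0_congr (tval_upd_freshVar m))
  | ball x t φ ih =>
    simp only [Fml.sub, sat0_ball, tval_sub]
    exact forall_congr' fun m => imp_congr_right fun _ =>
      ih.trans (sat0_congr (tval_upd_freshVar m))
  | bex x t φ ih =>
    simp only [Fml.sub, sat0_bex, tval_sub]
    exact exists_congr fun m => and_congr_right fun _ =>
      ih.trans (sat0_congr (tval_upd_freshVar m))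
  | sall i φ ih => simp [Fml.sub]
  | sex i φ ih => simp [Fml.sub]

end Satisfaction

theorem Delta0.sub {φ : Fml} (h : Delta0 φ) (σ : ℕ → Term) : Delta0 (φ.sub σ) := by
  induction h generalizing σ with
  | eq t u => exact .eq _ _
  | lt t u => exact .lt _ _
  | not _ ih => exact .not (ih σ)
  | and _ _ ih ih' => exact .and (ih σ) (ih' σ)
  | or _ _ ih ih' => exact .or (ih σ) (ih' σ)
  | imp _ _ ih ih' => exact .imp (ih σ) (ih' σ)
  | ball x t _ ih => exact .ball _ _ (ih _)
  | bex x t _ ih => exact .bex _ _ (ih _)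

/-! ## Models of `PA⁻` as ordered semirings -/

section Algebra

variable {T : Str}

/-- The commutative semiring underlying a model of `PA⁻`. -/
@[reducible] def PAminus.commSemiring (h : PAminus T) : CommSemiring T.M where
  add := T.add
  mul := T.mul
  zero := T.zero
  one := T.one
  add_assoc := h.add_assoc
  add_comm := h.add_comm
  zero_add a := (h.add_comm _ _).trans (h.add_zero a)
  add_zero := h.add_zero
  mul_assoc := h.mul_assoc
  mul_comm := h.mul_comm
  one_mul a := (h.mul_comm _ _).trans (h.mul_one a)
  mul_one := h.mul_one
  zero_mul a := (h.mul_comm _ _).trans (h.mul_zero a)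
  mul_zero := h.mul_zero
  left_distrib := h.distrib
  right_distrib a b c := by
    change T.mul (T.add a b) c = T.add (T.mul a c) (T.mul b c)
    rw [h.mul_comm, h.distrib, h.mul_comm c a, h.mul_comm c b]
  nsmul := @nsmulRec _ ⟨T.zero⟩ ⟨T.add⟩
  nsmul_zero _ := rfl
  nsmul_succ _ _ := rfl
  npow := @npowRec _ ⟨T.one⟩ ⟨T.mul⟩
  npow_zero _ := rfl
  npow_succ _ _ := rfl

open Classical in
/-- The linear order underlying a model of `PA⁻`. -/
@[reducible] noncomputable def PAminus.linearOrder (h : PAminus T) : LinearOrder T.M where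
  le a b := a = b ∨ T.lt a b
  lt := T.lt
  le_refl a := .inl rfl
  le_trans := by
    rintro a b c (rfl | hab) (rfl | hbc)
    exacts [.inl rfl, .inr hbc, .inr hab, .inr (h.lt_trans _ _ _ hab hbc)]
  le_antisymm := by
    rintro a b (rfl | hab) (hba | hba)
    exacts [rfl, rfl, hba.symm, (h.lt_irrefl _ (h.lt_trans _ _ _ hab hba)).elim]
  lt_iff_le_not_ge a b := by
    refine ⟨fun hab => ⟨.inr hab, ?_⟩, ?_⟩
    · rintro (rfl | hba)
      exacts [h.lt_irrefl _ hab, h.lt_irrefl _ (h.lt_trans _ _ _ hab hba)]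
    · rintro ⟨rfl | hab, hn⟩
      exacts [(hn (.inl rfl)).elim, hab]
  le_total a b := by
    rcases h.lt_total a b with hab | rfl | hab
    exacts [.inl (.inr hab), .inl (.inl rfl), .inr (.inr hab)]
  toDecidableLE := Classical.decRel _

/-- Discretely ordered commutative semirings in which `a ≤ b` is witnessed by subtraction. -/
class DiscreteSemiring (R : Type) extends CommSemiring R, LinearOrder R where
  add_lt_add_right' : ∀ a b c : R, a < b → a + c < b + c
  mul_lt_mul_right' : ∀ a b c : R, a < b → 0 < c → a * c < b * c
  zero_lt_one' : (0 : R) < 1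
  nonneg : ∀ a : R, 0 ≤ a
  add_one_le : ∀ {a b : R}, a < b → a + 1 ≤ b
  exists_add : ∀ {a b : R}, a ≤ b → ∃ c, b = a + c
  exists_pred : ∀ {a : R}, 0 < a → ∃ b, a = b + 1

/-- A model of `PA⁻` is a discretely ordered semiring. -/
@[reducible] noncomputable def PAminus.discreteSemiring (h : PAminus T) : DiscreteSemiring T.M where
  __ := h.commSemiring
  __ := h.linearOrder
  add_lt_add_right' := h.add_lt_add
  mul_lt_mul_right' := h.mul_lt_mul
  zero_lt_one' := h.zero_lt_one
  nonneg a := (h.zero_le a).imp Eq.symm id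
  add_one_le := by
    intro a b hab
    exact h.discrete a b hab
  exists_add := by
    rintro a b (rfl | hab)
    · exact ⟨T.zero, (h.add_zero a).symm⟩
    · obtain ⟨c, hc⟩ := h.sub a b hab
      exact ⟨c, hc.symm⟩
  exists_pred := by
    intro a ha
    obtain ⟨b, hb⟩ := h.pred a ha
    exact ⟨b, hb.symm⟩

end Algebra

namespace DiscreteSemiring

variable {R : Type} [DiscreteSemiring R]

instance : IsStrictOrderedRing R where
  add_le_add_left a b hab c := by
    rcases hab.eq_or_lt with rfl | hab
    exacts [le_rfl, (add_lt_add_right' a b c hab).le]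
  le_of_add_le_add_left a b c h := by
    by_contra! hcb
    have := add_lt_add_right' _ _ a hcb
    rw [add_comm c a, add_comm b a] at this
    exact absurd h this.not_ge
  zero_le_one := zero_lt_one'.le
  exists_pair_ne := ⟨0, 1, zero_lt_one'.ne⟩
  mul_lt_mul_of_pos_left a ha b c hbc := by
    simpa only [mul_comm] using mul_lt_mul_right' b c a hbc ha
  mul_lt_mul_of_pos_right a ha b c hbc := mul_lt_mul_right' b c a hbc ha

theorem lt_add_one_iff' {a b : R} : a < b + 1 ↔ a ≤ b := by
  refine ⟨fun h => ?_, fun h => h.trans_lt (lt_add_one b)⟩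
  by_contra! hba
  exact absurd h (add_one_le hba).not_gt

theorem le_mul_self' (a : R) : a ≤ a * a := by
  rcases (nonneg a).eq_or_lt with h | h
  · simp [← h]
  · have := add_one_le h
    rw [zero_add] at this
    exact le_mul_of_one_le_left (nonneg a) this

/-- The quadratic pairing function is injective. -/
theorem pair_injective {x y x' y' : R}
    (h : (x + y) * (x + y) + x = (x' + y') * (x' + y') + x') : x = x' ∧ y = y' := by
  have key : ∀ {x y x' y' : R}, (x + y) * (x + y) + x = (x' + y') * (x' + y') + x' →
      ¬ x + y < x' + y' := by
    intro x y x' y' h hlt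
    have h1 := add_one_le hlt
    have h2 : (x + y + 1) * (x + y + 1) ≤ (x' + y') * (x' + y') :=
      mul_le_mul h1 h1 (nonneg _) (nonneg _)
    refine absurd h (ne_of_lt ?_)
    linear_combination h2 + nonneg x + 2 * nonneg y + nonneg x' + zero_lt_one' (R := R)
  have hs : x + y = x' + y' := le_antisymm (not_lt.1 (key h.symm)) (not_lt.1 (key h))
  rw [hs] at h
  have hx := add_left_cancel h
  subst hx
  exact ⟨rfl, add_left_cancel hs⟩

theorem left_le_pair (x y : R) : x ≤ (x + y) * (x + y) + x :=
  le_add_of_nonneg_left (nonneg _)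

theorem right_le_pair (x y : R) : y ≤ (x + y) * (x + y) + x :=
  (le_add_of_nonneg_left (nonneg x)).trans
    ((le_mul_self' _).trans (le_add_of_nonneg_right (nonneg x)))

theorem quotient_le {d q r q' r' : R} (h : d * q + r = d * q' + r') (hr' : r' < d) : q ≤ q' := by
  by_contra! hlt
  have h1 : d * (q' + 1) ≤ d * q := mul_le_mul_of_nonneg_left (add_one_le hlt) (nonneg _)
  refine absurd h (ne_of_gt ?_)
  linear_combination h1 + nonneg r + hr'

theorem div_unique {d q r q' r' : R} (h : d * q + r = d * q' + r') (hr : r < d) (hr' : r' < d) :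
    q = q' ∧ r = r' := by
  have hq := le_antisymm (quotient_le h hr') (quotient_le h.symm hr)
  subst hq
  exact ⟨rfl, add_left_cancel h⟩

/-- If `p` is the `j`-th power of two, then `BitAt p c` says that the `j`-th bit of `c` is `1`. -/
def BitAt (p c : R) : Prop := ∃ u w, w < p ∧ c = u * (p + p) + p + w

/-- Bits are not affected by adding multiples of higher powers of two. -/
theorem bitAt_add_iff {p q c : R} (hdiv : ∃ u w, w < q + q ∧ c = (q + q) * u + w)
    (hpq : q + q ∣ p) : BitAt q (c + p) ↔ BitAt q c := by
  obtain ⟨r, rfl⟩ := hpq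
  constructor
  · rintro ⟨U, V, hV, h⟩
    obtain ⟨u, w, hw, rfl⟩ := hdiv
    have := (div_unique (d := q + q) (q := u + r) (r := w) (q' := U) (r' := q + V)
      (by linear_combination h) hw (by linear_combination hV)).2
    exact ⟨u, V, hV, by rw [this]; ring⟩
  · rintro ⟨U, V, hV, rfl⟩
    exact ⟨U + r, V, hV, by ring⟩

/-- Bits do not depend on the remainder modulo lower powers of two. -/
theorem BitAt.change_remainder {p q u w w' : R}
    (hdiv : ∀ V : R, ∃ t s, s < p + p ∧ V = (p + p) * t + s)
    (hpq : p + p ∣ q) (hw : w < p + p) (hw' : w' < p + p)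
    (h : BitAt q (u * (p + p) + w)) : BitAt q (u * (p + p) + w') := by
  obtain ⟨r, rfl⟩ := hpq
  obtain ⟨U, V, hV, h⟩ := h
  obtain ⟨t, s, hs, rfl⟩ := hdiv V
  obtain ⟨h1, h2⟩ := div_unique (d := p + p) (q := u) (r := w) (q' := U * (r + r) + r + t)
    (r' := s) (by linear_combination h) hw hs
  have ht : t < r := by
    by_contra! hrt
    have := mul_le_mul_of_nonneg_left hrt (nonneg (p + p))
    refine absurd hV (not_lt.2 ?_)
    linear_combination this + nonneg s
  refine ⟨U, (p + p) * t + w', ?_, by rw [h1]; ring⟩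
  have := mul_le_mul_of_nonneg_left (add_one_le ht) (nonneg (p + p))
  linear_combination this + hw'

section Bits

variable {Pw : R → R → Prop}

/-- The `j`-th bit of `s` is `1`, where `Pw` is the graph of exponentiation with base `2` and all
quantifiers are bounded by `s`. -/
def Bit (Pw : R → R → Prop) (s j : R) : Prop :=
  j < s ∧ ∃ p, p < s + 1 ∧ Pw j p ∧ ∃ u, u < s + 1 ∧ ∃ w, w < p ∧ s = u * (p + p) + p + w

theorem bit_iff_bitAt (huniq : ∀ {j p p'}, Pw j p → Pw j p' → p = p')
    (hlt : ∀ {j p}, Pw j p → j < p) {s j p : R} (hp : Pw j p) : Bit Pw s j ↔ BitAt p s := by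
  constructor
  · rintro ⟨-, p', -, hp', u, -, w, hw, h⟩
    obtain rfl := huniq hp hp'
    exact ⟨u, w, hw, h⟩
  · rintro ⟨u, w, hw, rfl⟩
    have hj := hlt hp
    have hpos : 0 < p := (nonneg j).trans_lt hj
    have hle : p ≤ u * (p + p) + p + w := by
      linear_combination mul_nonneg (nonneg u) (nonneg (p + p)) + nonneg w
    have hone := add_one_le hpos
    rw [zero_add] at hone
    have hu : u ≤ u * (p + p) :=
      le_mul_of_one_le_right (nonneg u) (hone.trans (le_add_of_nonneg_left (nonneg p)))
    refine ⟨hj.trans_le hle, p, lt_add_one_iff'.2 hle, hp, u, lt_add_one_iff'.2 ?_, w, hw, rfl⟩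
    linear_combination hu + nonneg p + nonneg w

theorem not_bitAt {p s : R} (hpos : 0 < p)
    (hdiv : ∀ d, 0 < d → ∀ c : R, ∃ u w, w < d ∧ c = d * u + w) (h : ¬ BitAt p s) :
    ∃ u w, w < p ∧ s = u * (p + p) + w := by
  obtain ⟨u, w, hw, rfl⟩ := hdiv (p + p) (add_pos hpos hpos) s
  refine ⟨u, w, ?_, by ring⟩
  by_contra! hpw
  obtain ⟨w', rfl⟩ := exists_add hpw
  exact h ⟨u, w', lt_of_add_lt_add_left hw, by ring⟩

/-- Adding `2 ^ i` to a number with `i`-th bit `0` sets that bit and changes no other bit. -/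
theorem bit_add_pow (htot : ∀ j, ∃ p, Pw j p) (huniq : ∀ {j p p'}, Pw j p → Pw j p' → p = p')
    (hlt : ∀ {j p}, Pw j p → j < p) (hdvd : ∀ {i j p q}, Pw i p → Pw j q → i < j → p + p ∣ q)
    (hdiv : ∀ d, 0 < d → ∀ c : R, ∃ u w, w < d ∧ c = d * u + w) {s i p : R} (hp : Pw i p)
    (hi : ¬ Bit Pw s i) (j : R) : Bit Pw (s + p) j ↔ Bit Pw s j ∨ j = i := by
  have hpos : ∀ {j p}, Pw j p → 0 < p := fun h => (nonneg _).trans_lt (hlt h)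
  obtain ⟨q, hq⟩ := htot j
  rw [bit_iff_bitAt (Pw := Pw) huniq hlt hq, bit_iff_bitAt (Pw := Pw) huniq hlt hq]
  rw [bit_iff_bitAt (Pw := Pw) huniq hlt hp] at hi
  rcases lt_trichotomy j i with hji | rfl | hij
  · rw [bitAt_add_iff (hdiv _ (add_pos (hpos hq) (hpos hq)) s) (hdvd hq hp hji)]
    simp [hji.ne]
  · obtain rfl := huniq hp hq
    obtain ⟨u, w, hw, rfl⟩ := not_bitAt (hpos hp) hdiv hi
    simp only [or_true, iff_true]
    exact ⟨u, w, hw, by ring⟩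
  · obtain ⟨u, w, hw, rfl⟩ := not_bitAt (hpos hp) hdiv hi
    have hdiv' := hdiv _ (add_pos (hpos hp) (hpos hp))
    have h1 : w < p + p := hw.trans (lt_add_of_pos_left p (hpos hp))
    have h2 : w + p < p + p := by linear_combination hw
    simp only [hij.ne', or_false, add_assoc]
    exact ⟨.change_remainder hdiv' (hdvd hp hq hij) h2 h1,
      .change_remainder hdiv' (hdvd hp hq hij) h1 h2⟩

theorem add_pow_lt (huniq : ∀ {j p p'}, Pw j p → Pw j p' → p = p')
    (hlt : ∀ {j p}, Pw j p → j < p) (hdvd : ∀ {i j p q}, Pw i p → Pw j q → i < j → p + p ∣ q)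
    (hdiv : ∀ d, 0 < d → ∀ c : R, ∃ u w, w < d ∧ c = d * u + w) {s i p a C : R} (hp : Pw i p)
    (hC : Pw a C) (hi : ¬ Bit Pw s i) (hia : i < a) (hs : s < C) : s + p < C := by
  rw [bit_iff_bitAt (Pw := Pw) huniq hlt hp] at hi
  obtain ⟨r, rfl⟩ := hdvd hp hC hia
  obtain ⟨u, w, hw, rfl⟩ := not_bitAt ((nonneg _).trans_lt (hlt hp)) hdiv hi
  have hu : u < r := by
    by_contra! hru
    have := mul_le_mul_of_nonneg_left hru (nonneg (p + p))
    refine absurd hs (not_lt.2 ?_)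
    linear_combination this + nonneg w
  have := mul_le_mul_of_nonneg_left (add_one_le hu) (nonneg (p + p))
  linear_combination this + hw

end Bits

end DiscreteSemiring


/-! ## A semantic version of the arithmetic hierarchy -/

/-- A family of predicates on valuations, one for each structure. -/
def UPred : Type 1 := (T : Str) → (ℕ → T.M) → Prop

/-- Prepend an element to a valuation. -/
def scons {α : Type} (m : α) (v : ℕ → α) : ℕ → α
  | 0 => m
  | i + 1 => v i

@[simp] theorem scons_zero {α : Type} (m : α) (v : ℕ → α) : scons m v 0 = m := rfl
@[simp] theorem scons_succ {α : Type} (m : α) (v : ℕ → α) (i : ℕ) : scons m v (i + 1) = v i := rfl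

theorem comp_scons {α β : Type} (f : α → β) (m : α) (v : ℕ → α) :
    (fun i => f (scons m v i)) = scons (f m) fun i => f (v i) := by
  funext i
  cases i <;> rfl

theorem upd_scons_zero {α : Type} (m m' : α) (v : ℕ → α) : upd (scons m v) 0 m' = scons m' v := by
  funext i
  cases i <;> rfl

/-- Predicates definable by a `Δ₀` formula, uniformly in models of `PA⁻`. -/
def D0 (P : UPred) : Prop :=
  ∃ φ, Delta0 φ ∧ ∀ T, PAminus T → ∀ v, Sat0 T v φ ↔ P T v

namespace D0

variable {P Q : UPred}

theorem congr (h : D0 P) (hPQ : ∀ T, PAminus T → ∀ v, P T v ↔ Q T v) : D0 Q := by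
  obtain ⟨φ, hφ, hs⟩ := h
  exact ⟨φ, hφ, fun T hT v => (hs T hT v).trans (hPQ T hT v)⟩

theorem ofFml {φ : Fml} (h : Delta0 φ) : D0 fun T v => Sat0 T v φ :=
  ⟨φ, h, fun _ _ _ => Iff.rfl⟩

theorem eq (t u : Term) : D0 fun T v => tval T v t = tval T v u := ofFml (.eq t u)

theorem lt (t u : Term) : D0 fun T v => T.lt (tval T v t) (tval T v u) := ofFml (.lt t u)

theorem not (h : D0 P) : D0 fun T v => ¬ P T v := by
  obtain ⟨φ, hφ, hs⟩ := h
  exact ⟨.not φ, .not hφ, fun T hT v => not_congr (hs T hT v)⟩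

theorem and (h : D0 P) (h' : D0 Q) : D0 fun T v => P T v ∧ Q T v := by
  obtain ⟨φ, hφ, hs⟩ := h
  obtain ⟨ψ, hψ, hs'⟩ := h'
  exact ⟨.and φ ψ, .and hφ hψ, fun T hT v => and_congr (hs T hT v) (hs' T hT v)⟩

theorem or (h : D0 P) (h' : D0 Q) : D0 fun T v => P T v ∨ Q T v := by
  obtain ⟨φ, hφ, hs⟩ := h
  obtain ⟨ψ, hψ, hs'⟩ := h'
  exact ⟨.or φ ψ, .or hφ hψ, fun T hT v => or_congr (hs T hT v) (hs' T hT v)⟩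

theorem subst (h : D0 P) (σ : ℕ → Term) : D0 fun T v => P T fun i => tval T v (σ i) := by
  obtain ⟨φ, hφ, hs⟩ := h
  exact ⟨φ.sub σ, hφ.sub σ, fun T hT v => sat0_sub.trans (hs T hT _)⟩

theorem bex (t : Term) (h : D0 P) :
    D0 fun T v => ∃ m, T.lt m (tval T v t) ∧ P T (scons m v) := by
  obtain ⟨φ, hφ, hs⟩ := h
  refine ⟨.bex φ.vb t (φ.sub (scons (.var φ.vb) .var)), .bex _ _ (hφ.sub _), fun T hT v => ?_⟩
  refine exists_congr fun m => and_congr_right fun _ => ?_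
  refine sat0_sub.trans (.trans (sat0_congr ?_) (hs T hT _))
  rintro (_ | i) hi
  · simp [tval, upd]
  · have : i ≠ φ.vb := by omega
    simp [tval, upd, this]

theorem ball (t : Term) (h : D0 P) :
    D0 fun T v => ∀ m, T.lt m (tval T v t) → P T (scons m v) :=
  (h.not.bex t).not.congr fun _ _ _ => by push Not; rfl

end D0

/-- The semantic classes `Σₖ`: one existential quantifier in front of the negation of a
predicate of the previous level. -/
def Sg : ℕ → UPred → Prop
  | 0, P => D0 P
  | k + 1, P => ∃ Q, Sg k Q ∧ ∀ T, PAminus T → ∀ v, P T v ↔ ∃ m, ¬ Q T (scons m v)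

namespace Sg

variable {P Q : UPred} {k : ℕ}

theorem congr (h : Sg k P) (hPQ : ∀ T, PAminus T → ∀ v, P T v ↔ Q T v) : Sg k Q := by
  cases k with
  | zero => exact D0.congr h hPQ
  | succ k =>
    obtain ⟨R, hR, hs⟩ := h
    exact ⟨R, hR, fun T hT v => (hPQ T hT v).symm.trans (hs T hT v)⟩

theorem tval_lift {T : Str} (m : T.M) (v : ℕ → T.M) (σ : ℕ → Term) :
    (fun i => tval T (scons m v) (scons (.var 0) (fun i => (σ i).sub fun j => .var (j + 1)) i)) =
      scons m fun i => tval T v (σ i) := by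
  rw [comp_scons]
  congr 1
  funext i
  exact tval_sub _

theorem subst (h : Sg k P) (σ : ℕ → Term) : Sg k fun T v => P T fun i => tval T v (σ i) := by
  induction k generalizing P σ with
  | zero => exact D0.subst h σ
  | succ k ih =>
    obtain ⟨R, hR, hs⟩ := h
    refine ⟨_, ih hR (scons (.var 0) fun i => (σ i).sub fun j => .var (j + 1)),
      fun T hT v => (hs T hT _).trans (exists_congr fun m => ?_)⟩
    rw [tval_lift]

/-- Substitution, with the resulting valuation given in closed form. -/
theorem subst' (h : Sg k P) (σ : ℕ → Term) (f : (T : Str) → (ℕ → T.M) → ℕ → T.M)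
    (hf : ∀ T v i, tval T v (σ i) = f T v i) : Sg k fun T v => P T (f T v) :=
  (h.subst σ).congr fun T _ _ => by rw [funext (hf T _)]

theorem shift (h : Sg k P) : Sg k fun T v => P T fun i => v (i + 1) :=
  h.subst fun i => .var (i + 1)

theorem of_not (h : Sg k P) : Sg (k + 1) fun T v => ¬ P T v :=
  ⟨_, h.shift, fun T _ _ => ⟨fun hp => ⟨T.zero, hp⟩, fun ⟨_, hp⟩ => hp⟩⟩

theorem succ (h : Sg k P) : Sg (k + 1) P := by
  induction k generalizing P with
  | zero => exact (of_not (k := 0) (D0.not h)).congr fun _ _ _ => not_not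
  | succ k ih =>
    obtain ⟨R, hR, hs⟩ := h
    exact ⟨R, ih hR, hs⟩

theorem ofD0 (h : D0 P) : Sg k P := by
  induction k with
  | zero => exact h
  | succ k ih => exact ih.succ

theorem support (h : Sg k P) : ∃ N, ∀ T, PAminus T → ∀ v v' : ℕ → T.M,
    (∀ i < N, v i = v' i) → (P T v ↔ P T v') := by
  induction k generalizing P with
  | zero =>
    obtain ⟨φ, -, hs⟩ := h
    exact ⟨φ.vb, fun T hT v v' hv =>
      (hs T hT v).symm.trans ((sat0_congr hv).trans (hs T hT v'))⟩
  | succ k ih =>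
    obtain ⟨R, hR, hs⟩ := h
    obtain ⟨N, hN⟩ := ih hR
    refine ⟨N, fun T hT v v' hv => (hs T hT v).trans (.trans (exists_congr fun m => ?_)
      (hs T hT v').symm)⟩
    refine not_congr (hN T hT _ _ ?_)
    rintro (_ | i) hi
    · rfl
    · exact hv i (by omega)

end Sg

/-- The term for the pairing function. -/
def prT (t u : Term) : Term := .add (.mul (.add t u) (.add t u)) t

theorem PAminus.pair_injective {T : Str} (h : PAminus T) {x y x' y' : T.M}
    (hp : pairS T x y = pairS T x' y') : x = x' ∧ y = y' :=
  let _ := h.discreteSemiring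
  DiscreteSemiring.pair_injective hp

theorem PAminus.left_lt_pair {T : Str} (h : PAminus T) (x y : T.M) :
    T.lt x (T.add (pairS T x y) T.one) :=
  let _ := h.discreteSemiring
  DiscreteSemiring.lt_add_one_iff'.2 (DiscreteSemiring.left_le_pair x y)

theorem PAminus.right_lt_pair {T : Str} (h : PAminus T) (x y : T.M) :
    T.lt y (T.add (pairS T x y) T.one) :=
  let _ := h.discreteSemiring
  DiscreteSemiring.lt_add_one_iff'.2 (DiscreteSemiring.right_le_pair x y)

/-- Closure of `Σₖ` under conjunction, disjunction and bounded existential quantification. -/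
structure SgClosed (k : ℕ) : Prop where
  and : ∀ {P Q}, Sg k P → Sg k Q → Sg k fun T v => P T v ∧ Q T v
  or : ∀ {P Q}, Sg k P → Sg k Q → Sg k fun T v => P T v ∨ Q T v
  bex : ∀ {P} t, Sg k P → Sg k fun T v => ∃ m, T.lt m (tval T v t) ∧ P T (scons m v)

/-- `q = ⟨x, m⟩` for some `x, m`, where `q, v` is the valuation. -/
theorem D0.isPair : D0 fun T v => ∃ x, T.lt x (T.add (v 0) T.one) ∧
    ∃ m, T.lt m (T.add (v 0) T.one) ∧ v 0 = pairS T x m :=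
  (((D0.eq (.var 2) (prT (.var 1) (.var 0))).bex (.add (.var 1) .one)).bex (.add (.var 0) .one))

theorem SgClosed.ex_of {k : ℕ} (hk : SgClosed k) {P : UPred} (h : Sg (k + 1) P) :
    Sg (k + 1) fun T v => ∃ x, P T (scons x v) := by
  obtain ⟨Q, hQ, hs⟩ := h
  have hQ' := hk.bex (.add (.var 0) .one) (hk.bex (.add (.var 1) .one) (hk.and
    (.ofD0 (D0.eq (.var 2) (prT (.var 1) (.var 0))))
    (hQ.subst' (scons (.var 0) (scons (.var 1) fun i => .var (i + 3)))
      (fun T v => scons (v 0) (scons (v 1) fun i => v (i + 3)))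
      (by rintro T v (_ | _ | i) <;> rfl))))
  refine ⟨_, hk.or (.ofD0 D0.isPair.not) hQ', fun T hT v => ?_⟩
  simp only [hs T hT, not_or, not_not]
  constructor
  · rintro ⟨x, m, hxm⟩
    have hx := hT.left_lt_pair x m
    have hm := hT.right_lt_pair x m
    refine ⟨pairS T x m, ⟨x, hx, m, hm, rfl⟩, ?_⟩
    rintro ⟨x', -, m', -, hp, hQ⟩
    obtain ⟨rfl, rfl⟩ := hT.pair_injective (x := x) (y := m) hp
    exact hxm hQ
  · rintro ⟨q, ⟨x, hx, m, hm, hq⟩, hn⟩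
    exact ⟨x, m, fun hQ => hn ⟨x, hx, m, hm, hq, hQ⟩⟩

theorem sgClosed (k : ℕ) : SgClosed k := by
  induction k with
  | zero => exact ⟨D0.and, D0.or, D0.bex⟩
  | succ k hk =>
    have hand : ∀ {P Q}, Sg (k + 1) P → Sg (k + 1) Q → Sg (k + 1) fun T v => P T v ∧ Q T v := by
      rintro P Q ⟨R, hR, hs⟩ ⟨R', hR', hs'⟩
      have h1 : Sg (k + 1) fun T v => ∃ m', ¬ (R T v ∨
          R' T (scons m' fun i => v (i + 1))) :=
        ⟨_, hk.or hR.shift (hR'.subst' (scons (.var 0) fun i => .var (i + 2))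
          (fun T v => scons (v 0) fun i => v (i + 2)) (by rintro T v (_ | i) <;> rfl)),
          fun T hT v => Iff.rfl⟩
      refine (hk.ex_of h1).congr fun T hT v => ?_
      simp only [hs T hT, hs' T hT, not_or]
      constructor
      · rintro ⟨x, m', h, h'⟩
        exact ⟨⟨x, h⟩, m', h'⟩
      · rintro ⟨⟨x, h⟩, m', h'⟩
        exact ⟨x, m', h, h'⟩
    refine ⟨hand, ?_, fun t h => hk.ex_of (hand (P := fun T v =>
      T.lt (v 0) (tval T (fun i => v (i + 1)) t)) (.ofD0 ?_) h)⟩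
    · rintro P Q ⟨R, hR, hs⟩ ⟨R', hR', hs'⟩
      refine ⟨_, hk.and hR hR', fun T hT v => ?_⟩
      simp only [hs T hT, hs' T hT, not_and_or, exists_or]
    · exact ((D0.lt (.var 0) (t.sub fun j => .var (j + 1)))).congr fun T _ v => by
        rw [tval_sub]; rfl

namespace Sg

variable {P Q : UPred} {k : ℕ}

theorem and (h : Sg k P) (h' : Sg k Q) : Sg k fun T v => P T v ∧ Q T v := (sgClosed k).and h h'

theorem or (h : Sg k P) (h' : Sg k Q) : Sg k fun T v => P T v ∨ Q T v := (sgClosed k).or h h'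

theorem bex (t : Term) (h : Sg k P) :
    Sg k fun T v => ∃ m, T.lt m (tval T v t) ∧ P T (scons m v) := (sgClosed k).bex t h

theorem ex (h : Sg (k + 1) P) : Sg (k + 1) fun T v => ∃ x, P T (scons x v) :=
  (sgClosed k).ex_of h

theorem mono {l : ℕ} (hkl : k ≤ l) (h : Sg k P) : Sg l P := by
  induction l, hkl using Nat.le_induction with
  | base => exact h
  | succ l _ ih => exact ih.succ

/-- Semantic `Σₖ` predicates and their negations are definable by `Σₖ`, respectively `Πₖ`,
formulas. -/
theorem exists_fml (h : Sg k P) :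
    (∃ φ, IsSigma k φ ∧ ∀ T, PAminus T → ∀ v, Sat0 T v φ ↔ P T v) ∧
      ∃ φ, IsPi k φ ∧ ∀ T, PAminus T → ∀ v, Sat0 T v φ ↔ ¬ P T v := by
  induction k generalizing P with
  | zero =>
    obtain ⟨ψ, hψ, hs'⟩ := D0.not h
    obtain ⟨φ, hφ, hs⟩ := h
    exact ⟨⟨φ, .delta0 hφ, hs⟩, ψ, .delta0 hψ, hs'⟩
  | succ k ih =>
    obtain ⟨Q, hQ, hs⟩ := h
    obtain ⟨N, hN⟩ := hQ.support
    obtain ⟨⟨φ, hφ, hφs⟩, ⟨ψ, hψ, hψs⟩⟩ := ih (hQ.subst (scons (.var N) .var))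
    have key : ∀ T, PAminus T → ∀ v (m : T.M),
        Q T (fun i => tval T (upd v N m) (scons (.var N) .var i)) ↔ Q T (scons m v) := by
      refine fun T hT _ _ => hN T hT _ _ ?_
      rintro (_ | i) hi
      · simp [tval, upd]
      · have : i ≠ N := by omega
        simp [tval, upd, this]
    refine ⟨⟨.ex N ψ, .ex N (.ofPi hψ), fun T hT v => ?_⟩,
      .all N φ, .all N (.ofSigma hφ), fun T hT v => ?_⟩
    · simp only [sat0_ex, hψs T hT, hs T hT, key T hT]
    · simp only [sat0_all, hφs T hT, hs T hT, key T hT, not_exists, not_not]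

theorem upd_eq {T : Str} (v : ℕ → T.M) (x : ℕ) (m : T.M) :
    (fun i => tval T (scons m v) (if i = x then .var 0 else .var (i + 1))) = upd v x m := by
  funext i
  by_cases hi : i = x <;> simp [hi, upd, tval]

end Sg

mutual

theorem IsSigma.sg : ∀ {k : ℕ} {φ : Fml}, IsSigma k φ → Sg k fun T v => Sat0 T v φ
  | _, _, .delta0 h => .ofD0 (.ofFml h)
  | _, _, .ofPi h => (IsPi.sg h).of_not.congr fun _ _ _ => not_not
  | _, _, .ex x h => ((IsSigma.sg h).subst fun i => if i = x then .var 0 else .var (i + 1)).ex.congr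
      fun T _ v => by simp only [Sg.upd_eq, sat0_ex]

theorem IsPi.sg : ∀ {k : ℕ} {φ : Fml}, IsPi k φ → Sg k fun T v => ¬ Sat0 T v φ
  | _, _, .delta0 h => .ofD0 (D0.ofFml h).not
  | _, _, .ofSigma h => (IsSigma.sg h).of_not
  | _, _, .all x h => ((IsPi.sg h).subst fun i => if i = x then .var 0 else .var (i + 1)).ex.congr
      fun T _ v => by simp only [Sg.upd_eq, sat0_all, not_forall]

end


/-! ## Coding of finite sets by binary expansions -/

/-- `2 ^ j = p`, for the definition `E` of exponentiation. -/
def PowAt (E : Fml) (T : Str) (j p : T.M) : Prop := ExpAt T E (T.add T.one T.one) j p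

/-- The `j`-th binary digit of `s` is `1`, for the definition `E` of exponentiation. -/
def BitOf (E : Fml) (T : Str) (s j : T.M) : Prop :=
  T.lt j s ∧ ∃ p, T.lt p (T.add s T.one) ∧ PowAt E T j p ∧ ∃ u, T.lt u (T.add s T.one) ∧
    ∃ w, T.lt w p ∧ s = T.add (T.add (T.mul u (T.add p p)) p) w

theorem D0.powAt {E : Fml} (hE : Delta0 E) (t u : Term) :
    D0 fun T v => PowAt E T (tval T v t) (tval T v u) := by
  refine ((D0.ofFml hE).subst fun i =>
    if i = 0 then .add .one .one else if i = 1 then t else u).congr fun T _ v => ?_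
  have : (fun i => tval T v (if i = 0 then .add .one .one else if i = 1 then t else u)) =
      fun i => if i = 0 then T.add T.one T.one else if i = 1 then tval T v t else tval T v u := by
    funext i
    split_ifs <;> rfl
  simp only [this]
  rfl

theorem D0.bitOf {E : Fml} (hE : Delta0 E) (t u : Term) :
    D0 fun T v => BitOf E T (tval T v t) (tval T v u) := by
  have h : D0 fun T v => BitOf E T (v 0) (v 1) :=
    (D0.lt (.var 1) (.var 0)).and (((D0.powAt hE (.var 2) (.var 0)).and
      (((D0.eq (.var 3) (.add (.add (.mul (.var 1) (.add (.var 2) (.var 2))) (.var 2))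
        (.var 0))).bex (.var 1)).bex (.add (.var 1) .one))).bex (.add (.var 0) .one))
  exact h.subst (scons t fun _ => u)

/-- `Δ₀` induction for semantically `Δ₀` predicates. -/
theorem D0.induction {S : Str} (hS : IDelta0 S) {P : UPred} (h : D0 P) (v : ℕ → S.M)
    (h0 : P S (scons S.zero v))
    (hsucc : ∀ m, P S (scons m v) → P S (scons (S.add m S.one) v)) (m : S.M) :
    P S (scons m v) := by
  obtain ⟨φ, hφ, hs⟩ := h
  have := hS.2 φ hφ (scons S.zero v) 0
  simp only [upd_scons_zero, hs S hS.1] at this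
  exact this h0 hsucc m

section Ground

open DiscreteSemiring

variable {S : Str} {E : Fml}

theorem exists_div (hS : IDelta0 S) (d : S.M) (hd : S.lt S.zero d) (c : S.M) :
    ∃ u w, S.lt w d ∧ c = S.add (S.mul d u) w := by
  let _ := hS.1.discreteSemiring
  have h : D0 fun T v => ∃ u, T.lt u (T.add (v 0) T.one) ∧
      ∃ w, T.lt w (v 1) ∧ v 0 = T.add (T.mul (v 1) u) w :=
    ((D0.eq (.var 2) (.add (.mul (.var 3) (.var 1)) (.var 0))).bex (.var 2)).bex
      (.add (.var 0) .one)
  have key := h.induction hS (fun _ => d) ?_ ?_ c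
  · obtain ⟨u, -, w, hw, h⟩ := key
    exact ⟨u, w, hw, h⟩
  · refine ⟨S.zero, lt_add_one (0 : S.M), S.zero, hd, ?_⟩
    change (0 : S.M) = d * 0 + 0
    ring
  · rintro m ⟨u, hu, w, hw, h⟩
    simp only [scons_zero, scons_succ] at hu hw h ⊢
    rcases (add_one_le hw : w + 1 ≤ d).lt_or_eq with hlt | heq
    · refine ⟨u, ?_, w + 1, hlt, ?_⟩
      · exact lt_trans (show u < m + 1 from hu) (lt_add_one (m + 1))
      · change m + 1 = d * u + (w + 1)
        rw [show m = d * u + w from h]; ring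
    · refine ⟨u + 1, add_lt_add_left (show u < m + 1 from hu) 1, 0, hd, ?_⟩
      change m + 1 = d * (u + 1) + 0
      rw [show m = d * u + w from h, ← heq]; ring

theorem lt_of_powAt (hS : IDelta0 S) (hE : IsExpDef S E) {j p : S.M} (hp : PowAt E S j p) :
    S.lt j p := by
  let _ := hS.1.discreteSemiring
  have h : D0 fun T v => ∀ p, T.lt p (T.add (v 0) T.one) → ¬ PowAt E T (v 0) p :=
    (D0.powAt hE.delta0 (.var 1) (.var 0)).not.ball (.add (.var 0) .one)
  have key := h.induction hS (fun _ => S.zero) ?_ ?_ j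
  · by_contra! hjp
    exact key p (lt_add_one_iff'.2 (not_lt.1 hjp : p ≤ j)) hp
  · intro p hlt hp
    obtain rfl := hE.unique _ _ _ _ hp (hE.base _)
    have : (1 : S.M) < 0 + 1 := hlt
    simp at this
  · intro m hm p hlt hp
    simp only [scons_zero] at hm hlt hp
    obtain ⟨q, hq⟩ := hE.total (S.add S.one S.one) m
    obtain rfl := hE.unique _ _ _ _ hp (hE.step _ _ _ hq)
    have h1 : m + 1 ≤ q := not_lt.1 fun hlt => hm q hlt hq
    have h2 : q * (1 + 1) < m + 1 + 1 := hlt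
    refine absurd h2 (not_lt.2 ?_)
    linear_combination 2 * h1 + nonneg m

theorem dvd_of_powAt (hS : IDelta0 S) (hE : IsExpDef S E) {i j p q : S.M}
    (hp : PowAt E S i p) (hq : PowAt E S j q) (hij : S.lt i j) :
    ∃ r, q = S.mul (S.add p p) r := by
  let _ := hS.1.discreteSemiring
  have hpos : ∀ {j p}, PowAt E S j p → 0 < p := fun h =>
    (nonneg _).trans_lt (lt_of_powAt hS hE h)
  have hle : ∀ {a b : S.M}, q = a * b → a < q + 1 ∧ b < q + 1 := by
    intro a b hab
    have hq0 := hpos hq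
    have h1 : ∀ {a : S.M}, a ≠ 0 → 1 ≤ a := fun {a} ha => by
      simpa using add_one_le ((nonneg a).lt_of_ne' ha)
    rw [hab] at hq0
    have ha := h1 (left_ne_zero_of_mul hq0.ne')
    have hb := h1 (right_ne_zero_of_mul hq0.ne')
    rw [lt_add_one_iff', lt_add_one_iff', hab]
    exact ⟨le_mul_of_one_le_right (nonneg _) hb, le_mul_of_one_le_left (nonneg _) ha⟩
  have h : D0 fun T v => T.lt (v 1) (v 0) ∨ ∃ i, T.lt i (T.add (v 1) T.one) ∧
      T.add i (v 0) = v 1 ∧ ∃ p, T.lt p (T.add (v 2) T.one) ∧ PowAt E T i p ∧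
        ∃ r, T.lt r (T.add (v 2) T.one) ∧ v 2 = T.mul p r :=
    (D0.lt (.var 1) (.var 0)).or (((D0.eq (.add (.var 0) (.var 1)) (.var 2)).and
      (((D0.powAt hE.delta0 (.var 1) (.var 0)).and
        ((D0.eq (.var 5) (.mul (.var 1) (.var 0))).bex (.add (.var 4) .one))).bex
          (.add (.var 3) .one))).bex (.add (.var 1) .one))
  have key := h.induction hS (scons j fun _ => q) ?_ ?_
  · obtain ⟨k, hk⟩ := exists_add (add_one_le hij : i + 1 ≤ j)
    rcases key k with hlt | ⟨i', -, hi', p', -, hp', r, -, hr⟩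
    · have h1 : j < k := hlt
      have h2 : k ≤ j := hk ▸ le_add_of_nonneg_left (nonneg _)
      exact absurd h1 h2.not_gt
    · have h1 : i' + k = j := hi'
      rw [hk] at h1
      obtain rfl := add_right_cancel h1
      obtain rfl := hE.unique _ _ _ _ hp' (hE.step _ _ _ hp)
      refine ⟨r, ?_⟩
      change q = (p + p) * r
      rw [show q = p * (1 + 1) * r from hr]; ring
  · have h1 := hle (a := q) (b := 1) (mul_one q).symm
    exact .inr ⟨j, lt_add_one j, add_zero j, q, h1.1, hq, 1, h1.2, (mul_one q).symm⟩
  · rintro k (hlt | ⟨i', -, hi', p', -, hp', r, -, hr⟩)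
    · exact .inl (lt_trans hlt (lt_add_one k))
    · rcases (nonneg i').eq_or_lt with rfl | hpos'
      · left
        have h1 : 0 + k = j := hi'
        change j < k + 1
        rw [← h1, zero_add]
        exact lt_add_one k
      · obtain ⟨i, rfl⟩ := exists_pred hpos'
        obtain ⟨p, hp⟩ := hE.total (S.add S.one S.one) i
        obtain rfl := hE.unique _ _ _ _ hp' (hE.step _ _ _ hp)
        have h1 : i + 1 + k = j := hi'
        have h2 : q = p * (r + r) := by
          rw [show q = p * (1 + 1) * r from hr]; ring
        refine .inr ⟨i, ?_, ?_, p, (hle h2).1, hp, r + r, (hle h2).2, h2⟩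
        · change i < j + 1
          rw [lt_add_one_iff', ← h1, add_assoc]
          exact le_add_of_nonneg_right (nonneg _)
        · change i + (k + 1) = j
          rw [← h1]; ring

theorem bitOf_add_pow (hS : IDelta0 S) (hE : IsExpDef S E) {s i p : S.M} (hp : PowAt E S i p)
    (hi : ¬ BitOf E S s i) (j : S.M) : BitOf E S (S.add s p) j ↔ BitOf E S s j ∨ j = i :=
  let _ := hS.1.discreteSemiring
  bit_add_pow (Pw := PowAt E S) (hE.total _) (hE.unique _ _ _ _) (lt_of_powAt hS hE)
    (dvd_of_powAt hS hE) (exists_div hS) hp hi j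

theorem exists_insert (hS : IDelta0 S) (hE : IsExpDef S E) (s i : S.M) :
    ∃ s', S.lt s (S.add s' S.one) ∧ S.lt i s' ∧
      ∀ j, BitOf E S s' j ↔ BitOf E S s j ∨ j = i := by
  let _ := hS.1.discreteSemiring
  by_cases hi : BitOf E S s i
  · refine ⟨s, lt_add_one s, hi.1, fun j => ⟨.inl, ?_⟩⟩
    rintro (h | rfl) <;> assumption
  · obtain ⟨p, hp⟩ := hE.total (S.add S.one S.one) i
    refine ⟨S.add s p, ?_, ?_, bitOf_add_pow hS hE hp hi⟩
    · exact lt_add_one_iff'.2 (le_add_of_nonneg_right (nonneg p))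
    · exact (show i < p from lt_of_powAt hS hE hp).trans_le (le_add_of_nonneg_left (nonneg s))

theorem exists_insert_lt (hS : IDelta0 S) (hE : IsExpDef S E) {s i a C : S.M}
    (hC : PowAt E S a C) (hs : S.lt s C) (hia : S.lt i a) (hi : ¬ BitOf E S s i) :
    ∃ s', S.lt s' C ∧ S.lt s s' ∧ ∀ j, BitOf E S s' j ↔ BitOf E S s j ∨ j = i := by
  let _ := hS.1.discreteSemiring
  obtain ⟨p, hp⟩ := hE.total (S.add S.one S.one) i
  refine ⟨S.add s p, ?_, ?_, bitOf_add_pow hS hE hp hi⟩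
  · exact add_pow_lt (Pw := PowAt E S) (hE.unique _ _ _ _) (lt_of_powAt hS hE)
      (dvd_of_powAt hS hE) (exists_div hS) hp hC hi hia hs
  · exact lt_add_of_pos_right s ((nonneg i).trans_lt (lt_of_powAt hS hE hp))

end Ground


/-! ## Elementary end extensions -/

section Extension

variable {S K : Str} {e : Emb S K} {n : ℕ} {E : Fml}

theorem SigmaElem.sat0_of_forall (helem : SigmaElem e (n + 2)) {δ : Fml} (hδ : Delta0 δ)
    (hvb : δ.vb ≤ 3) (h : ∀ v : ℕ → S.M, Sat0 S v δ) (a b c : K.M) :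
    Sat0 K (scons a (scons b fun _ => c)) δ := by
  have hS : Sat0 S (fun _ => S.zero) (.all 0 (.all 1 (.all 2 δ))) := fun _ _ _ => h _
  refine (sat0_congr ?_).1
    ((helem _ (.ofPi (.all 0 (.all 1 (.all 2 (.delta0 hδ))))) _).1 hS a b c)
  intro i hi
  have hi3 : i < 3 := hi.trans_le hvb
  interval_cases i <;> rfl

/-- A `Σₙ₊₂`-elementary extension of a model of `PA⁻` is a model of `PA⁻`. -/
theorem SigmaElem.pAminus (hS : PAminus S) (helem : SigmaElem e (n + 2)) : PAminus K where
  add_assoc := helem.sat0_of_forall (.eq (.add (.add (.var 0) (.var 1)) (.var 2))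
    (.add (.var 0) (.add (.var 1) (.var 2)))) (by decide) fun _ => hS.add_assoc _ _ _
  add_comm a b := helem.sat0_of_forall (.eq (.add (.var 0) (.var 1)) (.add (.var 1) (.var 0)))
    (by decide) (fun _ => hS.add_comm _ _) a b a
  mul_assoc := helem.sat0_of_forall (.eq (.mul (.mul (.var 0) (.var 1)) (.var 2))
    (.mul (.var 0) (.mul (.var 1) (.var 2)))) (by decide) fun _ => hS.mul_assoc _ _ _
  mul_comm a b := helem.sat0_of_forall (.eq (.mul (.var 0) (.var 1)) (.mul (.var 1) (.var 0)))
    (by decide) (fun _ => hS.mul_comm _ _) a b a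
  distrib := helem.sat0_of_forall (.eq (.mul (.var 0) (.add (.var 1) (.var 2)))
    (.add (.mul (.var 0) (.var 1)) (.mul (.var 0) (.var 2)))) (by decide)
    fun _ => hS.distrib _ _ _
  add_zero a := helem.sat0_of_forall (.eq (.add (.var 0) .zero) (.var 0)) (by decide)
    (fun _ => hS.add_zero _) a a a
  mul_zero a := helem.sat0_of_forall (.eq (.mul (.var 0) .zero) .zero) (by decide)
    (fun _ => hS.mul_zero _) a a a
  mul_one a := helem.sat0_of_forall (.eq (.mul (.var 0) .one) (.var 0)) (by decide)
    (fun _ => hS.mul_one _) a a a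
  lt_irrefl a := helem.sat0_of_forall (.not (.lt (.var 0) (.var 0))) (by decide)
    (fun _ => hS.lt_irrefl _) a a a
  lt_trans := helem.sat0_of_forall (.imp (.lt (.var 0) (.var 1)) (.imp (.lt (.var 1) (.var 2))
    (.lt (.var 0) (.var 2)))) (by decide) fun _ => hS.lt_trans _ _ _
  lt_total a b := helem.sat0_of_forall (.or (.lt (.var 0) (.var 1)) (.or (.eq (.var 0) (.var 1))
    (.lt (.var 1) (.var 0)))) (by decide) (fun _ => hS.lt_total _ _) a b a
  add_lt_add := helem.sat0_of_forall (.imp (.lt (.var 0) (.var 1))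
    (.lt (.add (.var 0) (.var 2)) (.add (.var 1) (.var 2)))) (by decide)
    fun _ => hS.add_lt_add _ _ _
  mul_lt_mul := helem.sat0_of_forall (.imp (.lt (.var 0) (.var 1)) (.imp (.lt .zero (.var 2))
    (.lt (.mul (.var 0) (.var 2)) (.mul (.var 1) (.var 2))))) (by decide)
    fun _ => hS.mul_lt_mul _ _ _
  zero_lt_one := helem.sat0_of_forall (.lt .zero .one) (by decide) (fun _ => hS.zero_lt_one)
    K.zero K.zero K.zero
  zero_le a := helem.sat0_of_forall (.or (.eq (.var 0) .zero) (.lt .zero (.var 0))) (by decide)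
    (fun _ => hS.zero_le _) a a a
  discrete a b := helem.sat0_of_forall (.imp (.lt (.var 0) (.var 1))
    (.or (.eq (.add (.var 0) .one) (.var 1)) (.lt (.add (.var 0) .one) (.var 1)))) (by decide)
    (fun _ => hS.discrete _ _) a b a
  pred a ha := by
    let _ := hS.discreteSemiring
    have := helem.sat0_of_forall (δ := .imp (.lt .zero (.var 0)) (.bex 1 (.var 0)
      (.eq (.add (.var 1) .one) (.var 0)))) (.imp (.lt _ _) (.bex _ _ (.eq _ _))) (by decide)
      (fun v (hv : S.lt S.zero (v 0)) => by
        obtain ⟨b, hb⟩ := hS.pred _ hv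
        exact ⟨b, show S.lt b (v 0) from hb ▸ lt_add_one b, hb⟩) a a a
    obtain ⟨b, -, hb⟩ := this ha
    exact ⟨b, hb⟩
  sub a b hab := by
    let _ := hS.discreteSemiring
    have := helem.sat0_of_forall (δ := .imp (.lt (.var 0) (.var 1)) (.bex 2 (.add (.var 1) .one)
      (.eq (.add (.var 0) (.var 2)) (.var 1)))) (.imp (.lt _ _) (.bex _ _ (.eq _ _))) (by decide)
      (fun v (hv : S.lt (v 0) (v 1)) => by
        obtain ⟨c, hc⟩ := hS.sub _ _ hv
        refine ⟨c, show S.lt c (S.add (v 1) S.one) from hc ▸ ?_, hc⟩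
        exact DiscreteSemiring.lt_add_one_iff'.2
          (le_add_of_nonneg_left (DiscreteSemiring.nonneg (v 0)))) a b a
    obtain ⟨c, -, hc⟩ := this hab
    exact ⟨c, hc⟩

theorem Sg.transfer (hS : PAminus S) (hK : PAminus K) (helem : SigmaElem e n) {k : ℕ}
    (hk : k ≤ n) {P : UPred} (h : Sg k P) (v : ℕ → S.M) : P S v ↔ P K fun i => e.j (v i) := by
  obtain ⟨⟨φ, hφ, hs⟩, -⟩ := (h.mono hk).exists_fml
  exact (hs S hS v).symm.trans ((helem φ hφ v).trans (hs K hK _))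

theorem bitOf_map (hS : PAminus S) (hK : PAminus K) (helem : SigmaElem e n) (hE : Delta0 E)
    (s j : S.M) : BitOf E K (e.j s) (e.j j) ↔ BitOf E S s j :=
  (Sg.transfer (k := 0) hS hK helem (Nat.zero_le n) (D0.bitOf hE (.var 0) (.var 1))
    (scons s fun _ => j)).symm

theorem exists_insert_ext (hS : IDelta0 S) (hE : IsExpDef S E) (hK : PAminus K)
    (helem : SigmaElem e (n + 2)) (s i : K.M) :
    ∃ s', ∀ j, BitOf E K s' j ↔ BitOf E K s j ∨ j = i := by
  have h0 : D0 fun T v => (T.lt (v 1) (T.add (v 0) T.one) ∧ T.lt (v 2) (v 0)) ∧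
      ∀ j, T.lt j (T.add (v 0) T.one) →
        (BitOf E T (v 0) j ∧ (BitOf E T (v 1) j ∨ j = v 2)) ∨
          (¬ BitOf E T (v 0) j ∧ ¬ (BitOf E T (v 1) j ∨ j = v 2)) :=
    have hb := D0.bitOf hE.delta0 (.var 1) (.var 0)
    have hc := (D0.bitOf hE.delta0 (.var 2) (.var 0)).or (D0.eq (.var 0) (.var 3))
    ((D0.lt (.var 1) (.add (.var 0) .one)).and (D0.lt (.var 2) (.var 0))).and
      (((hb.and hc).or (hb.not.and hc.not)).ball (.add (.var 0) .one))
  have h2 := (Sg.ofD0 (k := 1) h0).ex.of_not.ex.ex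
  by_contra! hn
  have hKn := (Sg.transfer hS.1 hK helem (Nat.le_add_left 2 n) h2 fun _ => S.zero).2
    ⟨i, s, fun ⟨s', ⟨hs, hi⟩, hj⟩ => ?_⟩
  · obtain ⟨i, s, hns⟩ := hKn
    obtain ⟨s', hs, hi, hj⟩ := exists_insert hS hE s i
    refine hns ⟨s', ⟨hs, hi⟩, fun j _ => ?_⟩
    by_cases hb : BitOf E S s' j
    · exact .inl ⟨hb, (hj j).1 hb⟩
    · exact .inr ⟨hb, fun h => hb ((hj j).2 h)⟩
  · let _ := hK.discreteSemiring
    obtain ⟨j, hj'⟩ := hn s'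
    have hlt : K.lt j (K.add s' K.one) → (BitOf E K s' j ↔ BitOf E K s j ∨ j = i) := fun h => by
      rcases hj j h with ⟨h1, h2⟩ | ⟨h1, h2⟩
      · exact iff_of_true h1 h2
      · exact iff_of_false h1 h2
    rcases hj' with ⟨h1, h2, h3⟩ | ⟨h1, h2⟩
    · exact not_or.2 ⟨h2, h3⟩ ((hlt (lt_trans h1.1 (lt_add_one s'))).1 h1)
    · refine h1 ((hlt ?_).2 h2)
      rcases h2 with h2 | rfl
      · exact (show j < s from h2.1).trans hs
      · exact (show j < s' from hi).trans (lt_add_one _)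

/-- Induction up to an element of the ground model. -/
theorem Sg.induction (hS : PAminus S) (hK : PAminus K) (hMI : MISigma e n) {P : UPred}
    (h : Sg n P) (v : ℕ → K.M) (a : S.M) (h0 : P K (scons K.zero v))
    (hsucc : ∀ m, K.lt m (e.j a) → P K (scons m v) → P K (scons (K.add m K.one) v)) :
    P K (scons (e.j a) v) := by
  rcases hS.zero_le a with rfl | ha
  · rwa [e.zero]
  · obtain ⟨b, rfl⟩ := hS.pred a ha
    obtain ⟨⟨φ, hφ, hs⟩, -⟩ := h.exists_fml
    let _ := hS.discreteSemiring
    have hb : K.lt (e.j b) (e.j (S.add b S.one)) := (e.lt_iff _ _).1 (lt_add_one b)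
    have key := hMI φ hφ (scons K.zero v) 0 (S.add b S.one)
    simp only [upd_scons_zero, hs K hK] at key
    have := hsucc _ hb (key h0 hsucc _ hb)
    rwa [← e.one, ← e.add] at this

theorem bitOf_pair_lt {T : Str} (hT : PAminus T) {s y u : T.M} (h : BitOf E T s (pairS T y u)) :
    T.lt y s ∧ T.lt u s := by
  let _ := hT.discreteSemiring
  exact ⟨(DiscreteSemiring.left_le_pair y u).trans_lt h.1,
    (DiscreteSemiring.right_le_pair y u).trans_lt h.1⟩

/-- A bounded universal quantifier over a `Σₙ₊₁` predicate is implied by a `Σₙ₊₁` predicate to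
which it is equivalent in the extension, for bounds in the ground model. -/
theorem Sg.exists_coll (hS : PAminus S) (hK : PAminus K) (hE : Delta0 E)
    (hins : ∀ s i : K.M, ∃ s', ∀ j, BitOf E K s' j ↔ BitOf E K s j ∨ j = i)
    (hMI : MISigma e (n + 1)) {P : UPred} (h : Sg (n + 1) P) :
    ∃ R, Sg (n + 1) R ∧
      (∀ T, PAminus T → ∀ (v : ℕ → T.M) (a : T.M), R T (scons a v) →
        ∀ y, T.lt y a → P T (scons y v)) ∧
      ∀ (v : ℕ → K.M) (a : S.M), (∀ y, K.lt y (e.j a) → P K (scons y v)) →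
        R K (scons (e.j a) v) := by
  obtain ⟨Q, hQ, hs⟩ := h
  have hbit := D0.bitOf hE (.var 2) (prT (.var 1) (.var 0))
  have hQ' : Sg n fun T v => Q T (scons (v 0) (scons (v 1) fun i => v (i + 4))) :=
    hQ.subst' (scons (.var 0) (scons (.var 1) fun i => .var (i + 4)))
      (fun T v => scons (v 0) (scons (v 1) fun i => v (i + 4))) (by rintro T v (_ | _ | i) <;> rfl)
  have h1 : Sg (n + 1) fun T v => ∃ s, (∀ y u, BitOf E T s (pairS T y u) → T.lt y (v 0)) ∧
      ∀ y, T.lt y (v 0) → (∃ u, BitOf E T s (pairS T y u)) ∧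
        ∀ u, BitOf E T s (pairS T y u) → ¬ Q T (scons u (scons y fun i => v (i + 1))) := by
    refine ⟨_, (Sg.ofD0 (((hbit.and (D0.lt (.var 1) (.var 3)).not).bex (.var 1)).bex (.var 0))).or
      (((Sg.ofD0 (hbit.bex (.var 1)).not).or (((Sg.ofD0 hbit).and hQ').bex (.var 1))).bex (.var 1)),
      fun T hT v => exists_congr fun s => ?_⟩
    have hlt : ∀ {y u}, BitOf E T s (pairS T y u) → T.lt y s ∧ T.lt u s := bitOf_pair_lt hT
    constructor
    · rintro ⟨hc, hw⟩ (⟨y, -, u, -, hb, hy⟩ | ⟨y, hy, hn | ⟨u, -, hb, hq⟩⟩)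
      · exact hy (hc y u hb)
      · obtain ⟨u, hb⟩ := (hw y hy).1
        exact hn ⟨u, (hlt hb).2, hb⟩
      · exact (hw y hy).2 u hb hq
    · intro hn
      refine ⟨fun y u hb => ?_, fun y hy => ⟨?_, fun u hb hq => ?_⟩⟩
      · by_contra hy
        exact hn (.inl ⟨y, (hlt hb).1, u, (hlt hb).2, hb, hy⟩)
      · by_contra hu
        exact hn (.inr ⟨y, hy, .inl fun ⟨u, _, hb⟩ => hu ⟨u, hb⟩⟩)
      · exact hn (.inr ⟨y, hy, .inr ⟨u, (hlt hb).2, hb, hq⟩⟩)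
  refine ⟨_, h1, fun T hT v a ⟨s, _, hw⟩ y hy => ?_, fun v a hP => ?_⟩
  · obtain ⟨⟨u, hb⟩, hq⟩ := hw y hy
    exact (hs T hT _).2 ⟨u, hq u hb⟩
  · let _ := hK.discreteSemiring
    refine h1.induction hS hK hMI v a ⟨K.zero, fun y u hb => ?_, fun y hy => ?_⟩ ?_
    · exact ((show pairS K y u < 0 from hb.1).not_ge (DiscreteSemiring.nonneg _)).elim
    · exact ((show y < 0 from hy).not_ge (DiscreteSemiring.nonneg _)).elim
    · rintro m hm ⟨s, hc, hw⟩
      obtain ⟨u, hu⟩ := (hs K hK _).1 (hP m hm)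
      obtain ⟨s', hs'⟩ := hins s (pairS K m u)
      refine ⟨s', fun y u' hb => ?_, fun y hy => ⟨?_, fun u' hb => ?_⟩⟩
      · rcases (hs' _).1 hb with hb | heq
        · exact lt_trans (hc y u' hb) (lt_add_one m)
        · rw [(hK.pair_injective heq).1]
          exact lt_add_one m
      · rcases (DiscreteSemiring.lt_add_one_iff'.1 (show y < m + 1 from hy)).eq_or_lt with rfl | hlt
        · exact ⟨u, (hs' _).2 (.inr rfl)⟩
        · obtain ⟨u', hb⟩ := (hw y hlt).1
          exact ⟨u', (hs' _).2 (.inl hb)⟩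
      · rcases (hs' _).1 hb with hb | heq
        · exact (hw y (hc y u' hb)).2 u' hb
        · obtain ⟨rfl, rfl⟩ := hK.pair_injective heq
          exact hu

theorem IsEndExt.exists_eq (hend : IsEndExt e) (hK : PAminus K) {b : K.M} {a : S.M}
    (hb : K.lt b (e.j a)) : ∃ c, e.j c = b := by
  by_contra hn
  exact hK.lt_irrefl _ (hK.lt_trans _ _ _ hb (hend b hn a))

/-- Bounded parts of `Σₙ₊₁` predicates of the extension are coded in the ground model. -/
theorem Sg.exists_code (hS : IDelta0 S) (hE : IsExpDef S E) (hend : IsEndExt e)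
    (helem : SigmaElem e (n + 2)) (hMI : MISigma e (n + 1)) {X : UPred} (hX : Sg (n + 1) X)
    (w : ℕ → K.M) (a : S.M) :
    ∃ c, ∀ y, K.lt y (e.j a) → (BitOf E K (e.j c) y ↔ X K (scons y w)) := by
  have hK := helem.pAminus hS.1
  have hX' : Sg (n + 1) fun T v => X T (scons (v 0) fun i => v (i + 2)) :=
    hX.subst' (scons (.var 0) fun i => .var (i + 2)) (fun T v => scons (v 0) fun i => v (i + 2))
      (by rintro T v (_ | i) <;> rfl)
  obtain ⟨R, hR, hRP, hPR⟩ := Sg.exists_coll hS.1 hK hE.delta0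
    (exists_insert_ext hS hE hK helem) hMI
    ((Sg.ofD0 (D0.bitOf hE.delta0 (.var 1) (.var 0)).not).or hX')
  have hI : Sg (n + 1) fun T v => ∃ c, T.lt c (v 1) ∧
      ¬ T.lt c (v 0) ∧ R T (scons (v 2) (scons c fun i => v (i + 3))) :=
    Sg.bex (.var 1) ((Sg.ofD0 (D0.lt (.var 0) (.var 1)).not).and
      (hR.subst' (scons (.var 3) (scons (.var 0) fun i => .var (i + 4)))
        (fun T v => scons (v 3) (scons (v 0) fun i => v (i + 4)))
        (by rintro T v (_ | _ | i) <;> rfl)))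
  obtain ⟨C, hC⟩ := hE.total (S.add S.one S.one) a
  let _ := hS.1.discreteSemiring
  let _ := hK.discreteSemiring
  by_contra! hn
  have key := hI.induction hS.1 hK hMI (scons (e.j C) (scons (e.j a) w)) C ?_ ?_
  · obtain ⟨c, hc, hcC, -⟩ := key
    exact hcC hc
  · refine ⟨K.zero, ?_, hK.lt_irrefl _, hPR _ a fun y _ => .inl fun hb => ?_⟩
    · rw [← e.zero]
      exact (e.lt_iff _ _).1 ((DiscreteSemiring.nonneg a).trans_lt (lt_of_powAt hS hE hC))
    · exact (show y < 0 from hb.1).not_ge (DiscreteSemiring.nonneg _)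
  · rintro x - ⟨c, hc, hcx, hcR⟩
    obtain ⟨c, rfl⟩ := hend.exists_eq hK hc
    have hcX := hRP K hK _ _ hcR
    obtain ⟨y, hya, hy⟩ := hn c
    have hyX : ¬ BitOf E K (e.j c) y ∧ X K (scons y w) := by
      rcases hy with ⟨hb, hx⟩ | hy
      · exact ((hcX y hya).elim (fun h => h hb) hx).elim
      · exact hy
    obtain ⟨y, rfl⟩ := hend.exists_eq hK hya
    rw [bitOf_map hS.1 hK helem hE.delta0] at hyX
    obtain ⟨s, hsC, hcs, hs⟩ := exists_insert_lt hS hE hC ((e.lt_iff _ _).2 hc)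
      ((e.lt_iff _ _).2 hya) hyX.1
    refine ⟨e.j s, (e.lt_iff _ _).1 hsC, ?_, hPR _ a fun z hza => ?_⟩
    · exact not_lt.2 (DiscreteSemiring.add_one_le
        ((show x ≤ e.j c from not_lt.1 hcx).trans_lt ((e.lt_iff _ _).1 hcs)))
    · obtain ⟨z, rfl⟩ := hend.exists_eq hK hza
      rw [← imp_iff_not_or]
      intro hb
      rcases (hs z).1 ((bitOf_map hS.1 hK helem hE.delta0 _ _).1 hb) with hb | rfl
      · exact (hcX _ hza).resolve_left (not_not.2 ((bitOf_map hS.1 hK helem hE.delta0 _ _).2 hb))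
      · exact hyX.2

theorem Sg.weak_regularity (hS : IDelta0 S) (hE : IsExpDef S E) (hproper : IsProper e)
    (hend : IsEndExt e) (helem : SigmaElem e (n + 2)) (hMI : MISigma e (n + 1)) {X Y : UPred}
    (hX : Sg (n + 1) X) (hY : Sg (n + 1) Y) (v : ℕ → S.M) (a : S.M)
    (h : ∀ m, ∃ k, S.lt k a ∧ Y S (scons k (scons m v)) ∧ ¬ X S (scons k (scons m v))) :
    ∃ k, S.lt k a ∧ ∀ b, ∃ m, S.lt b m ∧
      Y S (scons k (scons m v)) ∧ ¬ X S (scons k (scons m v)) := by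
  have hK := helem.pAminus hS.1
  obtain ⟨d, hd⟩ := not_forall.1 hproper
  have key : ∃ k, K.lt k (e.j a) ∧ Y K (scons k (scons d fun i => e.j (v i))) ∧
      ¬ X K (scons k (scons d fun i => e.j (v i))) := by
    by_contra! hn
    obtain ⟨c, hc⟩ := Sg.exists_code hS hE hend helem hMI hX (scons d fun i => e.j (v i)) a
    have hX' : Sg (n + 1) fun T v => X T (scons (v 0) (scons (v 1) fun i => v (i + 3))) :=
      hX.subst' (scons (.var 0) (scons (.var 1) fun i => .var (i + 3)))
        (fun T v => scons (v 0) (scons (v 1) fun i => v (i + 3)))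
        (by rintro T v (_ | _ | i) <;> rfl)
    have hY' : Sg (n + 1) fun T v => Y T (scons (v 0) (scons (v 1) fun i => v (i + 4))) :=
      hY.subst' (scons (.var 0) (scons (.var 1) fun i => .var (i + 4)))
        (fun T v => scons (v 0) (scons (v 1) fun i => v (i + 4)))
        (by rintro T v (_ | _ | i) <;> rfl)
    obtain ⟨R, hR, hRP, hPR⟩ := Sg.exists_coll hS.1 hK hE.delta0
      (exists_insert_ext hS hE hK helem) hMI
      ((Sg.ofD0 (D0.bitOf hE.delta0 (.var 2) (.var 0)).not).or hX')
    have hR' : Sg (n + 2) fun T v => ∃ x,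
        R T (scons (v 1) (scons x (scons (v 0) fun i => v (i + 2)))) ∧
          ¬ ∃ y, T.lt y (v 1) ∧ Y T (scons y (scons x fun i => v (i + 2))) ∧
            ¬ BitOf E T (v 0) y :=
      Sg.ex ((hR.subst' (scons (.var 2) (scons (.var 0) (scons (.var 1) fun i => .var (i + 3))))
        (fun T v => scons (v 2) (scons (v 0) (scons (v 1) fun i => v (i + 3))))
        (by rintro T v (_ | _ | _ | i) <;> rfl)).succ.and
        (Sg.bex (.var 2) (hY'.and (.ofD0 (D0.bitOf hE.delta0 (.var 2) (.var 0)).not))).of_not)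
    have hR'S := (Sg.transfer hS.1 hK helem le_rfl hR' (scons c (scons a v))).2
      ⟨d, hPR _ a fun y hy => ?_, ?_⟩
    · obtain ⟨x, hx, hxn⟩ := hR'S
      obtain ⟨k, hk, hkY, hkX⟩ := h x
      refine hkX ((hRP S hS.1 _ _ hx k hk).resolve_left (not_not.2 ?_))
      by_contra hb
      exact hxn ⟨k, hk, hkY, hb⟩
    · exact imp_iff_not_or.1 fun hb => (hc y hy).1 hb
    · rintro ⟨y, hy, hyY, hb⟩
      exact hb ((hc y hy).2 (hn y hy hyY))
  obtain ⟨k, hk, hkY, hkX⟩ := key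
  obtain ⟨k, rfl⟩ := hend.exists_eq hK hk
  refine ⟨k, (e.lt_iff _ _).2 hk, fun b => ?_⟩
  have hσ : ∀ T v i, tval T v (scons (.var 2) (scons (.var 0) fun i => .var (i + 3)) i) =
      scons (v 2) (scons (v 0) fun i => v (i + 3)) i := by rintro T v (_ | _ | i) <;> rfl
  have hZ : Sg (n + 2) fun T v => ∃ m, T.lt (v 0) m ∧
      Y T (scons (v 1) (scons m fun i => v (i + 2))) ∧
        ¬ X T (scons (v 1) (scons m fun i => v (i + 2))) :=
    Sg.ex ((Sg.ofD0 (D0.lt (.var 1) (.var 0))).and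
      ((hY.subst' _ (fun T v => scons (v 2) (scons (v 0) fun i => v (i + 3))) hσ).succ.and
        (hX.subst' _ (fun T v => scons (v 2) (scons (v 0) fun i => v (i + 3))) hσ).of_not))
  exact (Sg.transfer hS.1 hK helem le_rfl hZ (scons b (scons k v))).2
    ⟨d, hend d (fun ⟨x, hx⟩ => hd ⟨x, hx⟩) b, hkY, hkX⟩

end Extension

theorem Sg.upd_upd {k : ℕ} {P : UPred} (h : Sg k P) (x y : ℕ) :
    Sg k fun T v => P T (upd (upd (fun i => v (i + 2)) x (v 1)) y (v 0)) :=
  h.subst' (fun i => if i = y then .var 0 else if i = x then .var 1 else .var (i + 2)) _ (by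
    intro T v i
    simp only [upd]
    split_ifs <;> rfl)

end PaperArith

namespace PaperArith

/-- Proposition `prop:ind->rdmodel`.
Fix `n ∈ ℕ`.  Let `M ⊨ IΔ₀ + exp`.  If `M` admits a proper
`Σₙ₊₂`-elementary end extension `K` with `K ⊨ M‑IΣₙ₊₁`, then `M` satisfies
`WR(Σₙ₊₁ ∧ Πₙ₊₁)`: the weak regularity principle holds in `M` for every
conjunction of a `Σₙ₊₁` and a `Πₙ₊₁` formula with parameters from `M`. -/
theorem statement_17 (n : ℕ) (S K : Str) (hS : IDelta0 S) (hexp : SatExp S)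
    (e : Emb S K) (hproper : IsProper e) (hend : IsEndExt e)
    (helem : SigmaElem e (n + 2)) (hMI : MISigma e (n + 1)) :
    WRFor S (SigmaAndPi (n + 1)) := by
  obtain ⟨E, hE⟩ := hexp
  rintro _ ⟨ψ, χ, hψ, hχ, rfl⟩ v x y - a h
  simpa using Sg.weak_regularity hS hE hproper hend helem hMI (hχ.sg.upd_upd x y)
    (hψ.sg.upd_upd x y) v a fun m => by simpa using h m

end PaperArith
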